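/- arXiv:2204.00608 — 5 statements merged into one kernel-verified Lean document; each statement's English description precedes it below -/
import Mathlib

section
/- Let R be a commutative Noetherian local ring complete with respect to its maximal ideal m, and let a ⊆ m be a proper ideal with S = R/a. Let K be a right-bounded complex of R-modules with Tor_n^R(K^i, S) = 0 for all n > 0 and each cohomology H^i(K) finitely generated over R. Then H^i(K) = 0 for all i > 0 if and only if H^i(K ⊗_R S) = 0 for all i > 0; and H^i(K) = 0 for all i if and only if H^i(K ⊗_R S) = 0 for all i. -/
open CategoryTheory

universe u

namespace VanishAux

open TensorProduct LinearMap

section mods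

variable {R : Type u} [CommRing R]

lemma nat {A B M N : Type u} [AddCommGroup A] [AddCommGroup B] [AddCommGroup M] [AddCommGroup N]
    [Module R A] [Module R B] [Module R M] [Module R N] (f : A →ₗ[R] B) (g : M →ₗ[R] N)
    (x : A ⊗[R] M) : lTensor B g (rTensor M f x) = rTensor N f (lTensor A g x) := by
  rw [← LinearMap.comp_apply, ← LinearMap.comp_apply, lTensor_comp_rTensor, rTensor_comp_lTensor]

variable {P : ℕ → Type u} [∀ k, AddCommGroup (P k)] [∀ k, Module R (P k)]
  (d : ∀ k, P (k + 1) →ₗ[R] P k) {S : Type u} [AddCommGroup S] [Module R S] (e : P 0 →ₗ[R] S)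

/-- Acyclicity of a module with respect to a fixed resolution. -/
def Acyc (X : Type u) [AddCommGroup X] [Module R X] : Prop :=
  ∀ k, Function.Exact (lTensor X (d (k + 1))) (lTensor X (d k))

variable {A B C : Type u} [AddCommGroup A] [AddCommGroup B] [AddCommGroup C]
    [Module R A] [Module R B] [Module R C] {i : A →ₗ[R] B} {p : B →ₗ[R] C}

lemma acyc_left [∀ k, Module.Flat R (P k)] (hi : Function.Injective i) (hip : Function.Exact i p)
    (hp : Function.Surjective p) (hdd : ∀ k x, d k (d (k + 1) x) = 0)
    (hB : Acyc d B) (hC : Acyc d C) : Acyc d A := by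
  have hI : ∀ k, Function.Injective (rTensor (P k) i) := fun k =>
    Module.Flat.rTensor_preserves_injective_linearMap i hi
  have hE : ∀ k, Function.Exact (rTensor (P k) i) (rTensor (P k) p) := fun k =>
    rTensor_exact _ hip hp
  intro k a
  constructor
  · intro ha
    obtain ⟨b', hb'⟩ := (hB k (rTensor _ i a)).1 (by rw [nat, ha, map_zero])
    obtain ⟨c, hc⟩ := (hC (k + 1) (rTensor _ p b')).1 (by
      rw [nat, hb', (hE _).apply_apply_eq_zero])
    obtain ⟨b, rfl⟩ := rTensor_surjective _ hp c
    obtain ⟨a', ha'⟩ := (hE _ (b' - lTensor _ (d (k+2)) b)).1 (by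
      rw [map_sub, ← nat, hc, sub_self])
    refine ⟨a', hI _ ?_⟩
    rw [← nat, ha', map_sub, hb', (hB (k+1)).apply_apply_eq_zero, sub_zero]
  · rintro ⟨x, rfl⟩
    rw [← LinearMap.comp_apply, ← lTensor_comp]
    have : d k ∘ₗ d (k+1) = 0 := by ext x; exact hdd k x
    rw [this, lTensor_zero, LinearMap.zero_apply]

lemma inj_left [∀ k, Module.Flat R (P k)] (hi : Function.Injective i) (hip : Function.Exact i p)
    (hp : Function.Surjective p) (hde : Function.Exact (d 0) e) (he : Function.Surjective e)
    (hdd : ∀ k x, d k (d (k + 1) x) = 0)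
    (hC : Acyc d C) : Function.Injective (rTensor S i) := by
  have hI : ∀ k, Function.Injective (rTensor (P k) i) := fun k =>
    Module.Flat.rTensor_preserves_injective_linearMap i hi
  have hE : ∀ k, Function.Exact (rTensor (P k) i) (rTensor (P k) p) := fun k =>
    rTensor_exact _ hip hp
  rw [injective_iff_map_eq_zero]
  intro x hx
  obtain ⟨y, rfl⟩ := lTensor_surjective _ he x
  rw [← nat] at hx
  obtain ⟨z, hz⟩ := (lTensor_exact B hde he _).1 hx
  obtain ⟨c, hc⟩ := (hC 0 (rTensor _ p z)).1 (by
      rw [nat, hz, (hE _).apply_apply_eq_zero])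
  obtain ⟨b, rfl⟩ := rTensor_surjective _ hp c
  obtain ⟨w, hw⟩ := (hE _ (z - lTensor _ (d 1) b)).1 (by
      rw [map_sub, ← nat, hc, sub_self])
  have : lTensor A (d 0) w = y := by
    apply hI
    rw [← nat, hw, map_sub, hz, ← LinearMap.comp_apply (lTensor B (d 0)), ← lTensor_comp]
    have : d 0 ∘ₗ d (0+1) = 0 := by ext x; exact hdd 0 x
    rw [this, lTensor_zero, LinearMap.zero_apply, sub_zero]
  rw [← this, (lTensor_exact A hde he).apply_apply_eq_zero]

/-- The induction predicate, for the kernel of a differential. -/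
def Q {X Y : Type u} [AddCommGroup X] [AddCommGroup Y] [Module R X] [Module R Y] (S : Type u)
    [AddCommGroup S] [Module R S]
    (g : X →ₗ[R] Y) : Prop := Acyc d (ker g) ∧ Function.Injective (rTensor S (ker g).subtype)

variable {D : Type u} [AddCommGroup D] [Module R D] {f : A →ₗ[R] B} {g : B →ₗ[R] C} {h : C →ₗ[R] D}

lemma Q_step [∀ k, Module.Flat R (P k)] (hde : Function.Exact (d 0) e)
    (he : Function.Surjective e)
    (hdd : ∀ k x, d k (d (k + 1) x) = 0) (hgh : Function.Exact g h)
    (hB : Acyc d B) (hQ : Q d S h) : Q d S g := by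
  let p : B →ₗ[R] ker h := g.codRestrict (ker h) (fun x => hgh.apply_apply_eq_zero x)
  have hp : Function.Surjective p := by
    rintro ⟨y, hy⟩
    obtain ⟨x, rfl⟩ := (hgh y).1 hy
    exact ⟨x, rfl⟩
  have hip : Function.Exact (ker g).subtype p := by
    intro x
    rw [← (LinearMap.exact_subtype_ker_map g) x]
    exact Subtype.ext_iff
  exact ⟨acyc_left d (Submodule.injective_subtype _) hip hp hdd hB hQ.1,
    inj_left d e (Submodule.injective_subtype _) hip hp hde he hdd hQ.1⟩

lemma exact_ker (hgh : Function.Exact g h) (hQ : Q d S h) :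
    Function.Exact (rTensor S (ker g).subtype) (rTensor S g) := by
  let p : B →ₗ[R] ker h := g.codRestrict (ker h) (fun x => hgh.apply_apply_eq_zero x)
  have hp : Function.Surjective p := by
    rintro ⟨y, hy⟩
    obtain ⟨x, rfl⟩ := (hgh y).1 hy
    exact ⟨x, rfl⟩
  have hip : Function.Exact (ker g).subtype p := by
    intro x
    rw [← (LinearMap.exact_subtype_ker_map g) x]
    exact Subtype.ext_iff
  have hg : rTensor S g = rTensor S (ker h).subtype ∘ₗ rTensor S p := by
    rw [← rTensor_comp]; rfl
  intro x
  rw [← rTensor_exact S hip hp x, hg, LinearMap.comp_apply, map_eq_zero_iff _ hQ.2]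

lemma exact_iff (hfg : ∀ x, g (f x) = 0) (hgh : Function.Exact g h) (hQ : Q d S h)
    (hQ' : Q d S g) :
    Function.Exact (rTensor S f) (rTensor S g) ↔
      Function.Surjective (rTensor S (f.codRestrict (ker g) hfg)) := by
  have hE := exact_ker d hgh hQ
  have hf : rTensor S f = rTensor S (ker g).subtype ∘ₗ rTensor S (f.codRestrict (ker g) hfg) := by
    rw [← rTensor_comp]; rfl
  constructor
  · intro H y
    obtain ⟨x, hx⟩ := (H (rTensor S (ker g).subtype y)).1 (hE.apply_apply_eq_zero y)
    refine ⟨x, hQ'.2 ?_⟩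
    rw [← hx, hf]; rfl
  · intro H x
    rw [hE x, hf]
    constructor
    · rintro ⟨y, rfl⟩
      obtain ⟨z, rfl⟩ := H y
      exact ⟨z, rfl⟩
    · rintro ⟨z, rfl⟩
      exact ⟨_, rfl⟩

lemma nakayama [IsLocalRing R] (a : Ideal R) (ha : a ≤ IsLocalRing.maximalIdeal R)
    (f : A →ₗ[R] B) [Module.Finite R (B ⧸ range f)]
    (H : Function.Surjective (rTensor (R ⧸ a) f)) : Function.Surjective f := by
  have hs : Subsingleton ((B ⧸ range f) ⊗[R] (R ⧸ a)) := by
    refine subsingleton_of_forall_eq 0 fun x => ?_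
    obtain ⟨y, rfl⟩ := rTensor_surjective (R ⧸ a) (Submodule.mkQ_surjective (range f)) x
    obtain ⟨z, rfl⟩ := H y
    rw [← LinearMap.comp_apply, ← rTensor_comp, range_mkQ_comp, rTensor_zero, LinearMap.zero_apply]
  have hs2 : Subsingleton ((B ⧸ range f) ⧸ (a • ⊤ : Submodule R (B ⧸ range f))) :=
    (TensorProduct.tensorQuotEquivQuotSMul (B ⧸ range f) a).symm.toEquiv.subsingleton
  rw [Submodule.Quotient.subsingleton_iff] at hs2
  have : (⊤ : Submodule R (B ⧸ range f)) = ⊥ := by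
    refine Submodule.eq_bot_of_le_smul_of_le_jacobson_bot a _ Module.Finite.fg_top hs2.ge ?_
    exact ha.trans (IsLocalRing.maximalIdeal_le_jacobson _)
  have h3 : Subsingleton (B ⧸ range f) := (Submodule.subsingleton_iff R).1
    (subsingleton_of_bot_eq_top this.symm)
  rw [← range_eq_top, ← Submodule.Quotient.subsingleton_iff]
  exact h3

lemma key [IsLocalRing R] (a : Ideal R) (ha : a ≤ IsLocalRing.maximalIdeal R)
    (hfg : ∀ x, g (f x) = 0) (hgh : Function.Exact g h) (hQ : Q d (R ⧸ a) h)
    (hQ' : Q d (R ⧸ a) g) [Module.Finite R (ker g ⧸ range (f.codRestrict (ker g) hfg))] :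
    Function.Exact (rTensor (R ⧸ a) f) (rTensor (R ⧸ a) g) ↔ Function.Exact f g := by
  rw [exact_iff d hfg hgh hQ hQ']
  have : Function.Exact f g ↔ Function.Surjective (f.codRestrict (ker g) hfg) := by
    constructor
    · rintro H ⟨y, hy⟩
      obtain ⟨x, rfl⟩ := (H y).1 hy
      exact ⟨x, rfl⟩
    · intro H x
      constructor
      · intro hx
        obtain ⟨y, hy⟩ := H ⟨x, hx⟩
        exact ⟨y, congrArg Subtype.val hy⟩
      · rintro ⟨y, rfl⟩
        exact hfg y
  rw [this]
  exact ⟨nakayama a ha _, fun H => rTensor_surjective _ H⟩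

lemma Q_of_subsingleton [Subsingleton B] : Q d S g := by
  constructor
  · intro k x
    have : Subsingleton (ker g ⊗[R] P (k+1)) := inferInstance
    exact ⟨fun _ => ⟨0, Subsingleton.elim _ _⟩, fun _ => by
      rw [Subsingleton.elim x 0, map_zero]⟩
  · intro x y _
    exact Subsingleton.elim _ _

end mods

lemma acyc_of_tor {R : Type u} [CommRing R] (S : ModuleCat.{u} R) (P : ProjectiveResolution S)
    (X : ModuleCat.{u} R)
    (h : ∀ n : ℕ, 0 < n → Limits.IsZero (((Tor (ModuleCat.{u} R) n).obj X).obj S)) :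
    Acyc (P := fun k => P.complex.X k) (fun k => (P.complex.d (k+1) k).hom) X := by
  intro k
  have h1 := (h (k+1) (by omega)).of_iso
    (P.isoLeftDerivedObj ((MonoidalCategory.tensoringLeft _).obj X) (k+1)).symm
  have h2 : ((((MonoidalCategory.tensoringLeft _).obj X).mapHomologicalComplex _).obj
      P.complex).ExactAt (k+1) := by
    rw [HomologicalComplex.exactAt_iff_isZero_homology]; exact h1
  rw [HomologicalComplex.exactAt_iff' _ (k+2) (k+1) k (by simp) (by simp)] at h2
  exact (ShortComplex.ShortExact.moduleCat_exact_iff_function_exact _).1 h2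

lemma exists_res {R : Type u} [CommRing R] (S : Type u) [AddCommGroup S] [Module R S] :
    ∃ (P : ℕ → Type u) (_ : ∀ k, AddCommGroup (P k)) (_ : ∀ k, Module R (P k))
      (d : ∀ k, P (k + 1) →ₗ[R] P k) (e : P 0 →ₗ[R] S),
      (∀ k, Module.Flat R (P k)) ∧ (∀ k x, d k (d (k + 1) x) = 0) ∧ Function.Surjective e ∧
      Function.Exact (d 0) e ∧ ∀ X : ModuleCat.{u} R,
      (∀ n : ℕ, 0 < n → Limits.IsZero (((Tor (ModuleCat.{u} R) n).obj X).obj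
        (ModuleCat.of R S))) → Acyc d X := by
  let P : ProjectiveResolution (ModuleCat.of R S) := projectiveResolution _
  have hflat : ∀ k, Module.Flat R (P.complex.X k) := fun k => by
    have : Module.Projective R (P.complex.X k) :=
      (IsProjective.iff_projective (P.complex.X k)).2 (P.projective k)
    infer_instance
  let d : ∀ k, P.complex.X (k+1) →ₗ[R] P.complex.X k := fun k => (P.complex.d (k+1) k).hom
  let e : P.complex.X 0 →ₗ[R] S := (P.π.f 0).hom
  have hdd : ∀ k x, d k (d (k + 1) x) = 0 := fun k x => by
    have := congrArg (fun t => t.hom x) (P.complex.d_comp_d (k+2) (k+1) k)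
    exact this
  have he : Function.Surjective e := (ModuleCat.epi_iff_surjective (P.π.f 0)).1 inferInstance
  have hde : Function.Exact (d 0) e := by
    have := ShortComplex.exact_of_g_is_cokernel
      (ShortComplex.mk _ _ P.complex_d_comp_π_f_zero) P.isColimitCokernelCofork
    exact (ShortComplex.ShortExact.moduleCat_exact_iff_function_exact _).1 this
  exact ⟨fun k => P.complex.X k, inferInstance, inferInstance, d, e, hflat, hdd, he, hde,
    fun X hX => acyc_of_tor _ P X hX⟩

lemma exact_ext {R : Type u} [CommRing R] (a : Ideal R) {A B C : ModuleCat.{u} R}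
    (f : A ⟶ B) (g : B ⟶ C) :
    Function.Exact ((ModuleCat.extendScalars (Ideal.Quotient.mk a)).map f)
      ((ModuleCat.extendScalars (Ideal.Quotient.mk a)).map g) ↔
    Function.Exact (rTensor (R ⧸ a) f.hom) (rTensor (R ⧸ a) g.hom) := by
  rw [LinearMap.rTensor_exact_iff_lTensor_exact]
  exact Iff.rfl

end VanishAux

open VanishAux

theorem vanishing_cohomology_iff_of_complete_local
    {R : Type u} [CommRing R] [IsNoetherianRing R] [IsLocalRing R]
    (hcomplete : IsAdicComplete (IsLocalRing.maximalIdeal R) R)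
    (a : Ideal R) (ha : a ≤ IsLocalRing.maximalIdeal R)
    (K : CochainComplex (ModuleCat.{u} R) ℤ)
    (hbdd : ∃ b : ℤ, ∀ i, b < i → Limits.IsZero (K.X i))
    (htor : ∀ (i : ℤ) (n : ℕ), 0 < n →
      Limits.IsZero (((Tor (ModuleCat.{u} R) n).obj (K.X i)).obj
        (ModuleCat.of R (R ⧸ a))))
    (hfg : ∀ i : ℤ, Module.Finite R ↥(K.homology i)) :
    ((∀ i : ℤ, 0 < i → Limits.IsZero (K.homology i)) ↔
      (∀ i : ℤ, 0 < i → Limits.IsZero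
        ((((ModuleCat.extendScalars (Ideal.Quotient.mk a)).mapHomologicalComplex
          (ComplexShape.up ℤ)).obj K).homology i))) ∧
    ((∀ i : ℤ, Limits.IsZero (K.homology i)) ↔
      (∀ i : ℤ, Limits.IsZero
        ((((ModuleCat.extendScalars (Ideal.Quotient.mk a)).mapHomologicalComplex
          (ComplexShape.up ℤ)).obj K).homology i))) := by
  obtain ⟨b, hb⟩ := hbdd
  obtain ⟨PP, _, _, d, e, hflat, hdd, he, hde, hac'⟩ := exists_res (R := R) (R ⧸ a)
  have hac : ∀ i, Acyc d (K.X i) := fun i => hac' _ (htor i)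
  have h1 : ∀ i, Limits.IsZero (K.homology i) ↔
      Function.Exact (K.d (i-1) i).hom (K.d i (i+1)).hom := fun i => by
    rw [← HomologicalComplex.exactAt_iff_isZero_homology,
      HomologicalComplex.exactAt_iff' _ (i-1) i (i+1) (by simp) (by simp)]
    exact ShortComplex.ShortExact.moduleCat_exact_iff_function_exact _
  have h2 : ∀ i, Limits.IsZero
        ((((ModuleCat.extendScalars (Ideal.Quotient.mk a)).mapHomologicalComplex
          (ComplexShape.up ℤ)).obj K).homology i) ↔
      Function.Exact ((K.d (i-1) i).hom.rTensor (R ⧸ a))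
        ((K.d i (i+1)).hom.rTensor (R ⧸ a)) := fun i => by
    rw [← HomologicalComplex.exactAt_iff_isZero_homology,
      HomologicalComplex.exactAt_iff' _ (i-1) i (i+1) (by simp) (by simp), ← exact_ext]
    exact ShortComplex.ShortExact.moduleCat_exact_iff_function_exact _
  have hz : ∀ i x, (K.d i (i+1)).hom ((K.d (i-1) i).hom x) = 0 := fun i x => 
    congrArg (fun t => t.hom x) (K.d_comp_d (i-1) i (i+1))
  have hfin : ∀ i, Module.Finite R (LinearMap.ker (K.d i (i+1)).hom ⧸
      LinearMap.range ((K.d (i-1) i).hom.codRestrict (LinearMap.ker (K.d i (i+1)).hom) (hz i))) := by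
    intro i
    have := hfg i
    let e1 : K.homology i ≅ (K.sc' (i-1) i (i+1)).homology :=
      ShortComplex.homologyMapIso (K.isoSc' (i-1) i (i+1) (by simp) (by simp))
    let e2 := e1 ≪≫ (K.sc' (i-1) i (i+1)).moduleCatHomologyIso
    exact Module.Finite.equiv e2.toLinearEquiv
  have hstep : ∀ i, Function.Exact (K.d i (i+1)).hom (K.d (i+1) (i+1+1)).hom →
      Q d (R ⧸ a) (K.d (i+1) (i+1+1)).hom → Q d (R ⧸ a) (K.d i (i+1)).hom ∧
      (Function.Exact ((K.d (i-1) i).hom.rTensor (R ⧸ a))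
        ((K.d i (i+1)).hom.rTensor (R ⧸ a)) ↔ 
          Function.Exact (K.d (i-1) i).hom (K.d i (i+1)).hom) := by
    intro i hE hQ
    have hQ' := Q_step d e hde he hdd hE (hac i) hQ
    have := hfin i
    exact ⟨hQ', key d a ha (hz i) hE hQ hQ'⟩
  have hmain : ∀ n : ℤ, (∀ i, n < i → (Function.Exact ((K.d (i-1) i).hom.rTensor (R ⧸ a))
        ((K.d i (i+1)).hom.rTensor (R ⧸ a)) ∨
          Function.Exact (K.d (i-1) i).hom (K.d i (i+1)).hom)) →
      ∀ k : ℕ, ∀ i, n < i → b - k < i → (Q d (R ⧸ a) (K.d i (i+1)).hom ∧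
      Function.Exact ((K.d (i-1) i).hom.rTensor (R ⧸ a))
        ((K.d i (i+1)).hom.rTensor (R ⧸ a)) ∧
          Function.Exact (K.d (i-1) i).hom (K.d i (i+1)).hom) := by
    intro n hn k
    induction k with
    | zero =>
      intro i _ hi
      have : Subsingleton (K.X i) := ModuleCat.subsingleton_of_isZero (hb i (by simpa using hi))
      refine ⟨Q_of_subsingleton d, ?_, ?_⟩
      · intro x
        exact ⟨fun _ => ⟨0, Subsingleton.elim _ _⟩, fun _ => by
          rw [Subsingleton.elim x 0, map_zero]⟩
      · intro x
        exact ⟨fun _ => ⟨0, Subsingleton.elim _ _⟩, fun _ => by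
          rw [Subsingleton.elim x 0, map_zero]⟩
    | succ k ih =>
      intro i hi hik
      obtain ⟨q, -, ex⟩ := ih (i+1) (by omega) (by push_cast at hik; omega)
      rw [show i + 1 - 1 = i by ring] at ex
      obtain ⟨q', hiff⟩ := hstep i ex q
      have := hn i hi
      tauto
  have hmain' : ∀ n : ℤ, (∀ i, n < i → (Function.Exact ((K.d (i-1) i).hom.rTensor (R ⧸ a))
        ((K.d i (i+1)).hom.rTensor (R ⧸ a)) ∨
          Function.Exact (K.d (i-1) i).hom (K.d i (i+1)).hom)) →
      ∀ i, n < i → (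
      Function.Exact ((K.d (i-1) i).hom.rTensor (R ⧸ a))
        ((K.d i (i+1)).hom.rTensor (R ⧸ a)) ∧
          Function.Exact (K.d (i-1) i).hom (K.d i (i+1)).hom) := by
    intro n hn i hi
    exact (hmain n hn (b - i + 1).toNat i hi (by omega)).2
  simp only [h1, h2]
  refine ⟨⟨fun H i hi => (hmain' 0 (fun i hi => Or.inr (H i hi)) i hi).1,
    fun H i hi => (hmain' 0 (fun i hi => Or.inl (H i hi)) i hi).2⟩,
    ⟨fun H i => (hmain' (i-1) (fun i _ => Or.inr (H i)) i (by omega)).1,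
    fun H i => (hmain' (i-1) (fun i _ => Or.inl (H i)) i (by omega)).2⟩⟩
end

section
/- Let R be a Noetherian local ring complete with respect to its maximal ideal, a a proper ideal, S = R/a. Let K be a right-bounded complex of R-modules with Tor_+^R(K^i, S) = 0 and H^i(K) finitely generated for all i. Set M = H^0(K) and L = H^0(K ⊗_R S). If H^i(K ⊗_R S) = 0 for all i ≠ 0 and L is flat as an S-module, then H^i(K) = 0 for all i ≠ 0 and M is flat as an R-module. -/
open CategoryTheory

universe u

namespace FlatDescent

open TensorProduct LinearMap

section Facts

variable {R : Type u} [CommRing R]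
variable {A B C X F Ω : Type u} [AddCommGroup A] [AddCommGroup B] [AddCommGroup C]
  [AddCommGroup X] [AddCommGroup F] [AddCommGroup Ω]
  [Module R A] [Module R B] [Module R C] [Module R X] [Module R F] [Module R Ω]

lemma lr (f : A →ₗ[R] B) (g : X →ₗ[R] F) (x : A ⊗[R] X) :
    rTensor F f (lTensor A g x) = lTensor B g (rTensor X f x) := by
  rw [← LinearMap.comp_apply, ← LinearMap.comp_apply, rTensor_comp_lTensor, lTensor_comp_rTensor]

lemma fact_a (i : A →ₗ[R] B) (p : B →ₗ[R] C) (hi : Function.Injective i)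
    (hip : Function.Exact i p) (hp : Function.Surjective p)
    (ι : Ω →ₗ[R] F) (π : F →ₗ[R] X) (hιπ : Function.Exact ι π)
    (hπ : Function.Surjective π) [Module.Flat R F]
    (hT : Function.Injective (lTensor C ι)) : Function.Injective (rTensor X i) := by
  rw [injective_iff_map_eq_zero]
  intro x hx
  obtain ⟨y, rfl⟩ := lTensor_surjective A hπ x
  rw [lr] at hx
  obtain ⟨w, hw⟩ := (lTensor_exact B hιπ hπ _).1 hx
  have h1 : rTensor Ω p w = 0 := by
    apply hT
    rw [← lr, hw, map_zero]
    exact (rTensor_exact F hip hp).apply_apply_eq_zero y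
  obtain ⟨v, rfl⟩ := (rTensor_exact Ω hip hp _).1 h1
  have h2 : lTensor A ι v = y := by
    apply Module.Flat.rTensor_preserves_injective_linearMap (M := F) i hi
    rw [lr, hw]
  rw [← h2]
  exact (lTensor_exact A hιπ hπ).apply_apply_eq_zero v

lemma fact_b (i : A →ₗ[R] B) (p : B →ₗ[R] C)
    (hip : Function.Exact i p) (hp : Function.Surjective p)
    (ι : Ω →ₗ[R] F) (π : F →ₗ[R] X) (hιπ : Function.Exact ι π)
    (hπ : Function.Surjective π)
    (hB : Function.Injective (lTensor B ι)) (hi : Function.Injective (rTensor X i)) :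
    Function.Injective (lTensor C ι) := by
  rw [injective_iff_map_eq_zero]
  intro x hx
  obtain ⟨y, rfl⟩ := rTensor_surjective Ω hp x
  rw [← lr] at hx
  obtain ⟨z, hz⟩ := (rTensor_exact F hip hp _).1 hx
  have h1 : lTensor A π z = 0 := by
    apply hi
    rw [lr, hz, map_zero]
    exact (lTensor_exact B hιπ hπ).apply_apply_eq_zero y
  obtain ⟨w, rfl⟩ := (lTensor_exact A hιπ hπ _).1 h1
  have h2 : rTensor Ω i w = y := by
    apply hB
    rw [← lr, hz]
  rw [← h2]
  exact (rTensor_exact Ω hip hp).apply_apply_eq_zero w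

lemma fact_c (i : A →ₗ[R] B) (ι : Ω →ₗ[R] F) 
    (h1 : Function.Injective (rTensor Ω i)) (h2 : Function.Injective (lTensor B ι)) :
    Function.Injective (lTensor A ι) := by
  have : Function.Injective (rTensor F i ∘ₗ lTensor A ι) := by
    rw [rTensor_comp_lTensor, ← lTensor_comp_rTensor]
    exact h2.comp h1
  exact Function.Injective.of_comp (f := rTensor F i) this

end Facts

/-- A resolution of `X` by flat modules, cut into short exact sequences. -/
structure Syz (R : Type u) [CommRing R] (X : Type u) [AddCommGroup X] [Module R X] where
  Ω : ℕ → ModuleCat.{u} R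
  F : ℕ → ModuleCat.{u} R
  ι : ∀ k, Ω (k + 1) →ₗ[R] F k
  π : ∀ k, F k →ₗ[R] Ω k
  exact : ∀ k, Function.Exact (ι k) (π k)
  inj : ∀ k, Function.Injective (ι k)
  surj : ∀ k, Function.Surjective (π k)
  flat : ∀ k, Module.Flat R (F k)
  e : Ω 0 ≃ₗ[R] X

section Core

variable {R : Type u} [CommRing R] {a : Ideal R}

/-- Acyclicity with respect to the syzygy data. -/
def Acyc (D : Syz R (R ⧸ a)) (N : Type u) [AddCommGroup N] [Module R N] : Prop :=
  ∀ k, Function.Injective (lTensor N (D.ι k))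

variable (D : Syz R (R ⧸ a))
variable {A B C : Type u} [AddCommGroup A] [AddCommGroup B] [AddCommGroup C]
  [Module R A] [Module R B] [Module R C]

lemma inj_iff (i : A →ₗ[R] B) :
    Function.Injective (rTensor (D.Ω 0) i) ↔ Function.Injective (i.baseChange (R ⧸ a)) := by
  have h1 : Function.Injective (i.baseChange (R ⧸ a)) ↔
      Function.Injective (lTensor (R ⧸ a) i) := Iff.rfl
  rw [h1, LinearMap.lTensor_inj_iff_rTensor_inj]
  have h : rTensor (R ⧸ a) i ∘ₗ (D.e.lTensor A).toLinearMap =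
      (D.e.lTensor B).toLinearMap ∘ₗ rTensor (D.Ω 0) i := by
    ext; rfl
  have h' : ⇑(rTensor (R ⧸ a) i) ∘ (D.e.lTensor A) = (D.e.lTensor B) ∘ rTensor (D.Ω 0) i :=
    congrArg (fun f : _ →ₗ[R] _ => (f : _ → _)) h
  rw [← (D.e.lTensor B).injective.of_comp_iff, ← h']
  exact Function.Injective.of_comp_iff' _ (D.e.lTensor A).bijective

lemma Acyc.of_flat [Module.Flat R A] : Acyc D A := fun k =>
  Module.Flat.lTensor_preserves_injective_linearMap _ (D.inj k)

variable {D}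

lemma Acyc.rTensor_inj (hC : Acyc D C) (i : A →ₗ[R] B) (p : B →ₗ[R] C)
    (hi : Function.Injective i)
    (hip : Function.Exact i p) (hp : Function.Surjective p) (k : ℕ) :
    Function.Injective (rTensor (D.Ω k) i) :=
  have := D.flat k
  fact_a i p hi hip hp (D.ι k) (D.π k) (D.exact k) (D.surj k) (hC k)

lemma Acyc.left (hB : Acyc D B) (hC : Acyc D C) (i : A →ₗ[R] B) (p : B →ₗ[R] C)
    (hi : Function.Injective i)
    (hip : Function.Exact i p) (hp : Function.Surjective p) : Acyc D A := fun k =>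
  fact_c i (D.ι k) (hC.rTensor_inj i p hi hip hp (k + 1)) (hB k)

lemma nak [IsLocalRing R] (ha : a ≤ IsLocalRing.maximalIdeal R) [Module.Finite R A]
    (h : Subsingleton ((R ⧸ a) ⊗[R] A)) : Subsingleton A := by
  have h1 : Subsingleton (A ⧸ (a • (⊤ : Submodule R A))) :=
    (TensorProduct.quotTensorEquivQuotSMul A a).symm.toEquiv.subsingleton
  have h2 : a • (⊤ : Submodule R A) = ⊤ := Submodule.Quotient.subsingleton_iff.1 h1
  have h3 : (⊤ : Submodule R A) = ⊥ :=
    Submodule.eq_bot_of_le_smul_of_le_jacobson_bot a ⊤ Module.Finite.fg_top h2.ge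
      (by rwa [IsLocalRing.jacobson_eq_maximalIdeal ⊥ bot_ne_top])
  exact (Submodule.subsingleton_iff R).1 (subsingleton_of_bot_eq_top h3.symm)

lemma flat_aux [IsNoetherianRing R] [IsLocalRing R] (ha : a ≤ IsLocalRing.maximalIdeal R)
    [Module.Finite R A] [Module.Finite R B]
    (h0 : Function.Injective (lTensor A (D.ι 0)))
    (φ : B →ₗ[R] A) (hbij : Function.Bijective (φ.baseChange (R ⧸ a))) :
    Function.Bijective φ := by
  have hsurj : Function.Surjective φ := by
    rw [← LinearMap.range_eq_top, ← Submodule.Quotient.subsingleton_iff]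
    apply nak ha
    have hex := lTensor_exact (R ⧸ a) (LinearMap.exact_map_mkQ_range φ)
      (Submodule.mkQ_surjective _)
    refine ⟨fun x y => ?_⟩
    have key : ∀ x : (R ⧸ a) ⊗[R] (A ⧸ LinearMap.range φ), x = 0 := by
      intro x
      obtain ⟨z, rfl⟩ := lTensor_surjective (R ⧸ a) (Submodule.mkQ_surjective _) x
      exact (hex z).2 (hbij.2 z)
    rw [key x, key y]
  have hker : Function.Injective (rTensor (D.Ω 0) (LinearMap.ker φ).subtype) :=
    have := D.flat 0
    fact_a _ φ (Submodule.subtype_injective _) (LinearMap.exact_subtype_ker_map φ) hsurj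
      (D.ι 0) (D.π 0) (D.exact 0) (D.surj 0) h0
  rw [inj_iff] at hker
  have hinj : Subsingleton (LinearMap.ker φ) := by
    apply nak ha
    refine ⟨fun x y => hker (hbij.1 ?_)⟩
    have key : ∀ x, φ.baseChange (R ⧸ a) ((LinearMap.ker φ).subtype.baseChange (R ⧸ a) x) = 0 := by
      intro x
      exact (lTensor_exact (R ⧸ a) (LinearMap.exact_subtype_ker_map φ) hsurj).apply_apply_eq_zero x
    rw [key x, key y]
  refine ⟨?_, hsurj⟩
  rw [← LinearMap.ker_eq_bot]
  exact Submodule.subsingleton_iff_eq_bot.1 hinj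

lemma flat_crit [IsNoetherianRing R] [IsLocalRing R] (ha : a ≤ IsLocalRing.maximalIdeal R)
    [Module.Finite R A] (h0 : Function.Injective (lTensor A (D.ι 0)))
    (hS : Module.Flat (R ⧸ a) ((R ⧸ a) ⊗[R] A)) : Module.Flat R A := by
  have hne : Nontrivial (R ⧸ a) := Ideal.Quotient.nontrivial_iff.2
    (fun h => (IsLocalRing.maximalIdeal.isMaximal R).ne_top (top_le_iff.1 (h ▸ ha)))
  have : IsLocalRing (R ⧸ a) :=
    IsLocalRing.of_surjective' (Ideal.Quotient.mk a) Ideal.Quotient.mk_surjective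
  have : Module.Free (R ⧸ a) ((R ⧸ a) ⊗[R] A) := Module.free_of_flat_of_isLocalRing
  let b := Module.Free.chooseBasis (R ⧸ a) ((R ⧸ a) ⊗[R] A)
  have hs : ∀ x : (R ⧸ a) ⊗[R] A, ∃ m : A, (1 : R ⧸ a) ⊗ₜ[R] m = x := by
    intro x
    exact TensorProduct.mk_surjective R A (R ⧸ a) Ideal.Quotient.mk_surjective x
  choose v hv using fun i => hs (b i)
  let φ := Finsupp.linearCombination R v
  let c := (Finsupp.basisSingleOne (R := R)
    (ι := Module.Free.ChooseBasisIndex (R ⧸ a) ((R ⧸ a) ⊗[R] A))).baseChange (R ⧸ a)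
  have hφ : φ.baseChange (R ⧸ a) = (c.equiv b (Equiv.refl _)).toLinearMap := by
    apply c.ext
    intro i
    have h1 : c i = (1 : R ⧸ a) ⊗ₜ[R] (Finsupp.single i 1) := by simp [c]
    rw [LinearEquiv.coe_coe, Module.Basis.equiv_apply, h1]
    simp [φ, hv]
  have hbij : Function.Bijective (φ.baseChange (R ⧸ a)) := by
    rw [hφ]; exact (c.equiv b (Equiv.refl _)).bijective
  exact Module.Flat.of_linearEquiv (LinearEquiv.ofBijective φ (flat_aux ha h0 φ hbij)).symm

section Step

variable {V X Y W : Type u} [AddCommGroup V] [AddCommGroup X] [AddCommGroup Y] [AddCommGroup W]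
  [Module R V] [Module R X] [Module R Y] [Module R W]

/-- Good images: acyclic, and the inclusion stays injective after base change. -/
def Good (D : Syz R (R ⧸ a)) (g : Y →ₗ[R] W) : Prop :=
  Acyc D (LinearMap.range g) ∧ Function.Injective ((LinearMap.range g).subtype.baseChange (R ⧸ a))

lemma exact_ker_rangeRestrict (g : Y →ₗ[R] W) :
    Function.Exact (LinearMap.ker g).subtype g.rangeRestrict := by
  rw [LinearMap.exact_iff, LinearMap.ker_rangeRestrict, Submodule.range_subtype]

lemma step1 (g : Y →ₗ[R] W) (hY : Acyc D Y) (hg : Good D g) :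
    Acyc D (LinearMap.ker g) ∧
    Function.Injective ((LinearMap.ker g).subtype.baseChange (R ⧸ a)) ∧
    Function.Exact ((LinearMap.ker g).subtype.baseChange (R ⧸ a)) (g.baseChange (R ⧸ a)) := by
  have hs : Function.Surjective g.rangeRestrict := LinearMap.surjective_rangeRestrict g
  refine ⟨hY.left hg.1 _ _ (Submodule.subtype_injective _) (exact_ker_rangeRestrict g) hs,
    (inj_iff D _).1
      (hg.1.rTensor_inj _ _ (Submodule.subtype_injective _) (exact_ker_rangeRestrict g) hs 0), ?_⟩
  intro y
  have h1 := lTensor_exact (R ⧸ a) (exact_ker_rangeRestrict g) hs y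
  have h2 : g.baseChange (R ⧸ a) y = (LinearMap.range g).subtype.baseChange (R ⧸ a)
      (g.rangeRestrict.baseChange (R ⧸ a) y) := by
    rw [← LinearMap.comp_apply, ← LinearMap.baseChange_comp]
    rfl
  rw [h2, map_eq_zero_iff _ hg.2]
  exact h1

/-- The concrete homology of a pair of composable linear maps. -/
abbrev Hom0 {R : Type u} [CommRing R] {X Y W : Type u} [AddCommGroup X] [AddCommGroup Y]
    [AddCommGroup W] [Module R X] [Module R Y] [Module R W]
    (f : X →ₗ[R] Y) (g : Y →ₗ[R] W) (h : ∀ x, g (f x) = 0) : Type u :=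
  LinearMap.ker g ⧸ LinearMap.range (f.codRestrict (LinearMap.ker g) h)

lemma bc_zero (f : X →ₗ[R] Y) (g : Y →ₗ[R] W) (h : ∀ x, g (f x) = 0)
    (x : (R ⧸ a) ⊗[R] X) : g.baseChange (R ⧸ a) (f.baseChange (R ⧸ a) x) = 0 := by
  rw [← LinearMap.comp_apply, ← LinearMap.baseChange_comp]
  have : g ∘ₗ f = 0 := LinearMap.ext h
  rw [this, LinearMap.baseChange_zero, LinearMap.zero_apply]

lemma homology_ident {S : Type u} [CommRing S] {Z H : Type u} [AddCommGroup Z] [AddCommGroup H]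
    [Module S Z] [Module S H] [Module S X] [Module S Y] [Module S W]
    (f : X →ₗ[S] Y) (g : Y →ₗ[S] W) (h : ∀ x, g (f x) = 0)
    (p : X →ₗ[S] Z) (j : Z →ₗ[S] Y) (q : Z →ₗ[S] H)
    (hj : Function.Injective j) (hjg : Function.Exact j g)
    (hpj : ∀ x, j (p x) = f x) (hpq : Function.Exact p q) (hq : Function.Surjective q) :
    Nonempty (H ≃ₗ[S] Hom0 f g h) := by
  let t : Z →ₗ[S] LinearMap.ker g := j.codRestrict _ (fun z => hjg.apply_apply_eq_zero z)
  have ht : Function.Surjective t := by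
    rintro ⟨y, hy⟩
    obtain ⟨z, rfl⟩ := (hjg y).1 hy
    exact ⟨z, rfl⟩
  let s : Z →ₗ[S] Hom0 f g h := (Submodule.mkQ _) ∘ₗ t
  have hs : Function.Surjective s := (Submodule.mkQ_surjective _).comp ht
  have hk : LinearMap.ker q = LinearMap.ker s := by
    ext z
    rw [LinearMap.mem_ker, LinearMap.mem_ker, hpq z]
    simp only [s, LinearMap.comp_apply, Submodule.mkQ_apply, Submodule.Quotient.mk_eq_zero]
    constructor
    · rintro ⟨x, rfl⟩
      exact ⟨x, Subtype.ext (hpj x).symm⟩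
    · rintro ⟨x, hx⟩
      refine ⟨x, hj ?_⟩
      rw [hpj]
      exact congrArg Subtype.val hx
  exact ⟨(LinearMap.quotKerEquivOfSurjective q hq).symm ≪≫ₗ
    Submodule.quotEquivOfEq _ _ hk ≪≫ₗ LinearMap.quotKerEquivOfSurjective s hs⟩

lemma hom0_baseChange (f : X →ₗ[R] Y) (g : Y →ₗ[R] W) (h : ∀ x, g (f x) = 0)
    (hY : Acyc D Y) (hg : Good D g) :
    Nonempty (((R ⧸ a) ⊗[R] Hom0 f g h) ≃ₗ[R ⧸ a]
      Hom0 (f.baseChange (R ⧸ a)) (g.baseChange (R ⧸ a)) (bc_zero f g h)) := by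
  obtain ⟨-, h2, h3⟩ := step1 g hY hg
  refine homology_ident _ _ _ ((f.codRestrict (LinearMap.ker g) h).baseChange (R ⧸ a))
    ((LinearMap.ker g).subtype.baseChange (R ⧸ a))
    ((Submodule.mkQ (LinearMap.range (f.codRestrict (LinearMap.ker g) h))).baseChange (R ⧸ a))
    h2 h3 ?_ ?_ ?_
  · intro x
    rw [← LinearMap.comp_apply, ← LinearMap.baseChange_comp]
    rfl
  · exact lTensor_exact (R ⧸ a) (LinearMap.exact_map_mkQ_range _) (Submodule.mkQ_surjective _)
  · exact lTensor_surjective (R ⧸ a) (Submodule.mkQ_surjective _)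

lemma range_le (f : X →ₗ[R] Y) (g : Y →ₗ[R] W) (h : ∀ x, g (f x) = 0) :
    LinearMap.range f ≤ LinearMap.ker g := by
  rintro _ ⟨x, rfl⟩; exact h x

lemma exact_incl (f : X →ₗ[R] Y) (g : Y →ₗ[R] W) (h : ∀ x, g (f x) = 0) :
    Function.Exact (Submodule.inclusion (range_le f g h))
      (Submodule.mkQ (LinearMap.range (f.codRestrict (LinearMap.ker g) h))) := by
  intro y
  rw [Submodule.mkQ_apply, Submodule.Quotient.mk_eq_zero]
  constructor
  · rintro ⟨x, rfl⟩
    exact ⟨⟨f x, x, rfl⟩, rfl⟩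
  · rintro ⟨⟨_, x, rfl⟩, rfl⟩
    exact ⟨x, rfl⟩

lemma step2 (f : X →ₗ[R] Y) (g : Y →ₗ[R] W) (h : ∀ x, g (f x) = 0)
    (hY : Acyc D Y) (hg : Good D g) (hH : Module.Flat R (Hom0 f g h)) : Good D f := by
  obtain ⟨h1, h2, -⟩ := step1 g hY hg
  have hA : Acyc D (Hom0 f g h) := Acyc.of_flat D
  have hi := Submodule.inclusion_injective (range_le f g h)
  refine ⟨h1.left hA _ _ hi (exact_incl f g h) (Submodule.mkQ_surjective _), ?_⟩
  have h3 := (inj_iff D _).1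
    (hA.rTensor_inj _ _ hi (exact_incl f g h) (Submodule.mkQ_surjective _) 0)
  have h4 : (LinearMap.range f).subtype = (LinearMap.ker g).subtype ∘ₗ
      Submodule.inclusion (range_le f g h) := rfl
  rw [h4, LinearMap.baseChange_comp]
  exact h2.comp h3

lemma step3 (e : V →ₗ[R] X) (f : X →ₗ[R] Y) (g : Y →ₗ[R] W) (h : ∀ x, g (f x) = 0)
    (h' : ∀ x, f (e x) = 0)
    (hY : Acyc D Y) (hg : Good D g)
    (hex : Function.Exact (e.baseChange (R ⧸ a)) (f.baseChange (R ⧸ a))) :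
    Function.Injective (lTensor (Hom0 f g h) (D.ι 0)) := by
  obtain ⟨h1, h2, -⟩ := step1 g hY hg
  refine fact_b _ _ (exact_incl f g h) (Submodule.mkQ_surjective _) (D.ι 0) (D.π 0) (D.exact 0)
    (D.surj 0) (h1 0) ((inj_iff D _).2 ?_)
  rw [injective_iff_map_eq_zero]
  intro x hx
  obtain ⟨y, rfl⟩ := lTensor_surjective (R ⧸ a) (LinearMap.surjective_rangeRestrict f) x
  change (Submodule.inclusion (range_le f g h)).baseChange (R ⧸ a)
    (f.rangeRestrict.baseChange (R ⧸ a) y) = 0 at hx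
  have h3 : f.baseChange (R ⧸ a) y = 0 := by
    have h4 := congrArg ((LinearMap.ker g).subtype.baseChange (R ⧸ a)) hx
    rw [map_zero, ← LinearMap.comp_apply, ← LinearMap.comp_apply, ← LinearMap.baseChange_comp,
      ← LinearMap.baseChange_comp] at h4
    exact h4
  obtain ⟨w, rfl⟩ := (hex y).1 h3
  exact bc_zero e f.rangeRestrict (fun x => Subtype.ext (h' x)) w

lemma good_of_subsingleton (g : Y →ₗ[R] W) [Subsingleton W] : Good D g := by
  have : Subsingleton (LinearMap.range g) := inferInstance
  refine ⟨Acyc.of_flat D, fun x y _ => ?_⟩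
  exact Subsingleton.elim _ _

end Step

end Core

section Res

section
variable {R : Type u} [CommRing R]
  {A B C : Type u} [AddCommGroup A] [AddCommGroup B] [AddCommGroup C]
  [Module R A] [Module R B] [Module R C]

lemma exact_range_subtype (u : A →ₗ[R] B) (v : B →ₗ[R] C)
    (h : LinearMap.range u = LinearMap.ker v) :
    Function.Exact (LinearMap.range u).subtype v := by
  rw [LinearMap.exact_iff, Submodule.range_subtype, h]

lemma lTensor_range_inj (N : Type u) [AddCommGroup N] [Module R N]
    (u : A →ₗ[R] B) (v : B →ₗ[R] C)
    (h3 : LinearMap.range (lTensor N u) = LinearMap.ker (lTensor N v)) (h0 : v ∘ₗ u = 0) :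
    Function.Injective (lTensor N (LinearMap.range v).subtype) := by
  rw [injective_iff_map_eq_zero]
  intro x hx
  obtain ⟨y, rfl⟩ := lTensor_surjective N (LinearMap.surjective_rangeRestrict v) x
  have h4 : lTensor N v y = 0 := by
    rw [← hx, ← LinearMap.comp_apply, ← LinearMap.lTensor_comp]
    rfl
  obtain ⟨w, rfl⟩ : y ∈ LinearMap.range (lTensor N u) := by
    rw [h3]; exact h4
  rw [← LinearMap.comp_apply, ← LinearMap.lTensor_comp]
  have h5 : v.rangeRestrict ∘ₗ u = 0 := by
    ext x
    exact LinearMap.congr_fun h0 x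
  rw [h5, LinearMap.lTensor_zero, LinearMap.zero_apply]

end

variable {R : Type u} [CommRing R] {T : ModuleCat.{u} R} (P : ProjectiveResolution T)

/-- The syzygies of a projective resolution. -/
noncomputable def resΩ : ℕ → ModuleCat.{u} R
  | 0 => ((ChainComplex.single₀ (ModuleCat.{u} R)).obj T).X 0
  | (k + 1) => ModuleCat.of R (LinearMap.range (P.complex.d (k + 1) k).hom)

/-- The surjections onto the syzygies. -/
noncomputable def resπ : ∀ k, P.complex.X k →ₗ[R] resΩ P k
  | 0 => (P.π.f 0).hom
  | (k + 1) => (P.complex.d (k + 1) k).hom.rangeRestrict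

/-- Syzygy data of a projective resolution. -/
noncomputable def resSyz : Syz R T where
  Ω := resΩ P
  F := fun k => P.complex.X k
  ι := fun k => (LinearMap.range (P.complex.d (k + 1) k).hom).subtype
  π := resπ P
  exact := by
    intro k
    cases k with
    | zero => exact exact_range_subtype _ (P.π.f 0).hom P.exact₀.moduleCat_range_eq_ker
    | succ k =>
      exact exact_range_subtype _ (P.complex.d (k + 1) k).hom.rangeRestrict
        ((P.exact_succ k).moduleCat_range_eq_ker.trans (LinearMap.ker_rangeRestrict _).symm)
  inj := fun k => Submodule.subtype_injective _
  surj := by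
    intro k
    cases k with
    | zero => exact (ModuleCat.epi_iff_surjective _).1 (inferInstanceAs (Epi (P.π.f 0)))
    | succ k => exact LinearMap.surjective_rangeRestrict _
  flat := fun k => by
    have : Module.Projective R (P.complex.X k) :=
      (IsProjective.iff_projective (P.complex.X k)).2 (P.projective k)
    infer_instance
  e := ((HomologicalComplex.singleObjXSelf (ComplexShape.down ℕ) 0 T)).toLinearEquiv

lemma res_acyc (a : Ideal R) (P : ProjectiveResolution (ModuleCat.of R (R ⧸ a)))
    (N : ModuleCat.{u} R)
    (hN : ∀ n : ℕ, 0 < n → Limits.IsZero (((Tor (ModuleCat.{u} R) n).obj N).obj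
        (ModuleCat.of R (R ⧸ a)))) : Acyc (resSyz P) N := by
  intro k
  have h1 := (hN (k + 1) (Nat.succ_pos k)).of_iso
    (P.isoLeftDerivedObj ((MonoidalCategory.tensoringLeft (ModuleCat.{u} R)).obj N) (k + 1)).symm
  have h2 := ((HomologicalComplex.exactAt_iff' _ (k + 2) (k + 1) k
    (by simp only [ChainComplex.prev]; rfl) (by simp)).1
    ((HomologicalComplex.exactAt_iff_isZero_homology _ _).2 h1)).moduleCat_range_eq_ker
  have h3 : LinearMap.range (lTensor N (P.complex.d (k + 2) (k + 1)).hom) =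
    LinearMap.ker (lTensor N (P.complex.d (k + 1) k).hom) := h2
  exact lTensor_range_inj N _ _ h3
    (congrArg (fun f => f.hom) (P.complex.d_comp_d (k + 2) (k + 1) k))

end Res

section Cplx

variable {R : Type u} [CommRing R]

lemma homology_equiv (K : CochainComplex (ModuleCat.{u} R) ℤ) (i j k : ℤ) (hij : i + 1 = j)
    (hjk : j + 1 = k) (h : ∀ x, (K.d j k).hom ((K.d i j).hom x) = 0) :
    Nonempty (K.homology j ≃ₗ[R] Hom0 (K.d i j).hom (K.d j k).hom h) := by
  have e : K.homology j ≅ (K.sc' i j k).homology :=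
    ShortComplex.homologyMapIso (K.isoSc' i j k (by simp [← hij]) (by simp [← hjk]))
  exact ⟨(e ≪≫ (K.sc' i j k).moduleCatHomologyIso).toLinearEquiv⟩

lemma homology_equiv' (a : Ideal R) (K : CochainComplex (ModuleCat.{u} R) ℤ) (i j k : ℤ)
    (hij : i + 1 = j)
    (hjk : j + 1 = k) (h : ∀ x, (K.d j k).hom ((K.d i j).hom x) = 0) :
    Nonempty ((((ModuleCat.extendScalars (Ideal.Quotient.mk a)).mapHomologicalComplex
        (ComplexShape.up ℤ)).obj K).homology j ≃ₗ[R ⧸ a]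
      Hom0 ((K.d i j).hom.baseChange (R ⧸ a)) ((K.d j k).hom.baseChange (R ⧸ a))
        (bc_zero _ _ h)) := 
  homology_equiv (((ModuleCat.extendScalars (Ideal.Quotient.mk a)).mapHomologicalComplex
        (ComplexShape.up ℤ)).obj K) i j k hij hjk (bc_zero _ _ h)

lemma exact_of_hom0 {X Y W : Type u} [AddCommGroup X] [AddCommGroup Y]
    [AddCommGroup W] [Module R X] [Module R Y] [Module R W]
    (f : X →ₗ[R] Y) (g : Y →ₗ[R] W) (h : ∀ x, g (f x) = 0) (hs : Subsingleton (Hom0 f g h)) :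
    Function.Exact f g := by
  intro y
  constructor
  · intro hy
    have h1 := Submodule.Quotient.subsingleton_iff.1 hs
    have h2 : (⟨y, hy⟩ : LinearMap.ker g) ∈
      LinearMap.range (f.codRestrict (LinearMap.ker g) h) := by rw [h1]; trivial
    obtain ⟨x, hx⟩ := h2
    exact ⟨x, congrArg Subtype.val hx⟩
  · rintro ⟨x, rfl⟩
    exact h x

end Cplx
end FlatDescent

/-- Let `R` be a Noetherian local ring complete with respect to its
maximal ideal, `a` a proper ideal, `S = R/a`.  Let `K` be a right-bounded complex of
`R`-modules with `Tor_+^R(K^i, S) = 0` and `H^i(K)` finitely generated for all `i`.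
Set `M = H^0(K)` and `L = H^0(K ⊗_R S)`.  If `H^i(K ⊗_R S) = 0` for all `i ≠ 0` and `L`
is flat as an `S`-module, then `H^i(K) = 0` for all `i ≠ 0` and `M` is flat as an
`R`-module. -/
theorem flat_descent_of_complex
    {R : Type u} [CommRing R] [IsNoetherianRing R] [IsLocalRing R]
    (hcomplete : IsAdicComplete (IsLocalRing.maximalIdeal R) R)
    (a : Ideal R) (ha : a ≤ IsLocalRing.maximalIdeal R)
    (K : CochainComplex (ModuleCat.{u} R) ℤ)
    (hbdd : ∃ b : ℤ, ∀ i, b < i → Limits.IsZero (K.X i))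
    (htor : ∀ (i : ℤ) (n : ℕ), 0 < n →
      Limits.IsZero (((Tor (ModuleCat.{u} R) n).obj (K.X i)).obj
        (ModuleCat.of R (R ⧸ a))))
    (hfg : ∀ i : ℤ, Module.Finite R ↥(K.homology i))
    (hvanish : ∀ i : ℤ, i ≠ 0 → Limits.IsZero
      ((((ModuleCat.extendScalars (Ideal.Quotient.mk a)).mapHomologicalComplex
        (ComplexShape.up ℤ)).obj K).homology i))
    (hLflat : Module.Flat (R ⧸ a)
      ↥((((ModuleCat.extendScalars (Ideal.Quotient.mk a)).mapHomologicalComplex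
        (ComplexShape.up ℤ)).obj K).homology 0)) :
    (∀ i : ℤ, i ≠ 0 → Limits.IsZero (K.homology i)) ∧
    Module.Flat R ↥(K.homology 0) := by
  classical
  let D := FlatDescent.resSyz (projectiveResolution (ModuleCat.of R (R ⧸ a)))
  have hac : ∀ i, FlatDescent.Acyc D (K.X i) := fun i =>
    FlatDescent.res_acyc a _ (K.X i) (htor i)
  have hz : ∀ i j k : ℤ, ∀ x, (K.d j k).hom ((K.d i j).hom x) = 0 := fun i j k x =>
    congrArg (fun f => f.hom x) (K.d_comp_d i j k)
  -- the inductive step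
  have hne : ∀ h i j : ℤ, h + 1 = i → i + 1 = j → i ≠ 0 → FlatDescent.Good D (K.d i j).hom →
      Limits.IsZero (K.homology i) := by
    intro h i j hhi hij hi hg
    obtain ⟨e1⟩ := FlatDescent.homology_equiv K h i j hhi hij (hz h i j)
    obtain ⟨e2⟩ := FlatDescent.homology_equiv' a K h i j hhi hij (hz h i j)
    obtain ⟨e3⟩ := FlatDescent.hom0_baseChange _ _ (hz h i j) (hac i) hg
    have h1 := ModuleCat.subsingleton_of_isZero (hvanish i hi)
    have h2 := (e3 ≪≫ₗ e2.symm).toEquiv.subsingleton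
    have := hfg i
    have : Module.Finite R (FlatDescent.Hom0 _ _ (hz h i j)) := Module.Finite.equiv e1
    have h3 := FlatDescent.nak ha h2
    have h4 := e1.toEquiv.subsingleton
    exact ModuleCat.isZero_of_subsingleton _
  have hflat : ∀ h i j : ℤ, h + 1 = i → i + 1 = j → i = 0 → FlatDescent.Good D (K.d i j).hom →
      Module.Flat R (K.homology i) := by
    intro h i j hhi hij hi hg
    obtain ⟨e1⟩ := FlatDescent.homology_equiv K h i j hhi hij (hz h i j)
    obtain ⟨e2⟩ := FlatDescent.homology_equiv' a K h i j hhi hij (hz h i j)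
    obtain ⟨e3⟩ := FlatDescent.hom0_baseChange _ _ (hz h i j) (hac i) hg
    obtain ⟨e4⟩ := FlatDescent.homology_equiv' a K (h - 1) h i (by omega) hhi (hz (h - 1) h i)
    have h1 := ModuleCat.subsingleton_of_isZero (hvanish h (by omega))
    have h2 := e4.symm.toEquiv.subsingleton
    have hex := FlatDescent.exact_of_hom0 _ _ _ h2
    have := hfg i
    have : Module.Finite R (FlatDescent.Hom0 _ _ (hz h i j)) := Module.Finite.equiv e1
    have hfl : Module.Flat (R ⧸ a)
        (TensorProduct R (R ⧸ a) (FlatDescent.Hom0 _ _ (hz h i j))) := by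
      subst hi
      exact Module.Flat.of_linearEquiv (e3 ≪≫ₗ e2.symm)
    have h5 := FlatDescent.flat_crit ha
      (FlatDescent.step3 _ _ _ (hz h i j) (hz (h - 1) h i) (hac i) hg hex) hfl
    exact Module.Flat.of_linearEquiv e1
  have hfl' : ∀ h i j : ℤ, h + 1 = i → i + 1 = j → FlatDescent.Good D (K.d i j).hom →
      Module.Flat R (K.homology i) := by
    intro h i j hhi hij hg
    by_cases hi : i = 0
    · exact hflat h i j hhi hij hi hg
    · have := ModuleCat.subsingleton_of_isZero (hne h i j hhi hij hi hg)
      infer_instance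
  have hstep : ∀ h i j : ℤ, h + 1 = i → i + 1 = j → FlatDescent.Good D (K.d i j).hom →
      FlatDescent.Good D (K.d h i).hom := by
    intro h i j hhi hij hg
    obtain ⟨e1⟩ := FlatDescent.homology_equiv K h i j hhi hij (hz h i j)
    have := hfl' h i j hhi hij hg
    exact FlatDescent.step2 _ _ (hz h i j) (hac i) hg (Module.Flat.of_linearEquiv e1.symm)
  obtain ⟨b, hb⟩ := hbdd
  have hgood : ∀ i j : ℤ, i + 1 = j → FlatDescent.Good D (K.d i j).hom := by
    have hbig : ∀ i : ℤ, b ≤ i → ∀ j, i + 1 = j → FlatDescent.Good D (K.d i j).hom := by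
      intro i hi j hij
      have := ModuleCat.subsingleton_of_isZero (hb j (by omega))
      exact FlatDescent.good_of_subsingleton _
    intro i
    rcases le_total b i with hi | hi
    · exact hbig i hi
    · induction i, hi using Int.le_induction_down with
      | base => exact hbig b le_rfl
      | pred n hn ih =>
        intro j hj
        obtain rfl : j = n := by omega
        exact hstep _ _ (j + 1) hj rfl (ih _ rfl)
  refine ⟨fun i hi => hne (i - 1) i (i + 1) (by omega) rfl hi (hgood _ _ rfl),
    hfl' (-1) 0 1 (by omega) (by omega) (hgood _ _ (by omega))⟩
end

section
/- Let R be a complete local Noetherian ring and a a proper ideal such that R is normally flat along a, i.e. each a^n/a^{n+1} is flat (equivalently free, being finitely generated) as an R/a-module. Then R/a is Tor-rigid as an R-module: for every finitely generated R-module M and every n > 0, Tor_n^R(M, R/a) = 0 implies Tor_m^R(M, R/a) = 0 for all m ≥ n. -/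
open CategoryTheory

universe u

section helpers
open TensorProduct MonoidalCategory Limits

section core
variable {R : Type u} [CommRing R]

/-- The multiplication map `I ⊗ E → E`. -/
noncomputable def tmu (I : Ideal R) (E : Type u) [AddCommGroup E] [Module R E] :
    (I ⊗[R] E) →ₗ[R] E :=
  TensorProduct.lift ((LinearMap.lsmul R E).comp I.subtype)

lemma tmu_tmul (I : Ideal R) (E : Type u) [AddCommGroup E] [Module R E] (x : I) (e : E) :
    tmu I E (x ⊗ₜ e) = (x : R) • e := by simp [tmu]

lemma tmu_mem (I : Ideal R) (E : Type u) [AddCommGroup E] [Module R E] (t : I ⊗[R] E) :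
    tmu I E t ∈ (I • ⊤ : Submodule R E) := by
  induction t with
  | zero => simp
  | tmul x e => rw [tmu_tmul]; exact Submodule.smul_mem_smul x.2 trivial
  | add x y hx hy => rw [map_add]; exact add_mem hx hy

lemma exists_tmu (I : Ideal R) (E : Type u) [AddCommGroup E] [Module R E] (y : E)
    (hy : y ∈ (I • ⊤ : Submodule R E)) : ∃ t, tmu I E t = y := by
  induction hy using Submodule.smul_induction_on' with
  | smul r hr n hn => exact ⟨⟨r, hr⟩ ⊗ₜ n, tmu_tmul _ _ _ _⟩
  | add x hx y hy h1 h2 =>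
    obtain ⟨s, rfl⟩ := h1
    obtain ⟨t, rfl⟩ := h2
    exact ⟨s + t, map_add _ _ _⟩

lemma tmu_nat (I : Ideal R) {E K : Type u} [AddCommGroup E] [Module R E] [AddCommGroup K]
    [Module R K] (h : E →ₗ[R] K) (t : I ⊗[R] E) :
    tmu I K (h.lTensor I t) = h (tmu I E t) := by
  induction t with
  | zero => simp
  | tmul x e => simp [tmu_tmul]
  | add x y hx hy => simp [map_add, hx, hy]

lemma tmu_inj (I : Ideal R) (F : Type u) [AddCommGroup F] [Module R F] [Module.Flat R F] :
    Function.Injective (tmu I F) := by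
  have h : tmu I F = (TensorProduct.lid R F).toLinearMap ∘ₗ I.subtype.rTensor F := by
    ext; simp [tmu]
  rw [h, LinearMap.coe_comp]
  exact (TensorProduct.lid R F).injective.comp
    (Module.Flat.rTensor_preserves_injective_linearMap _ I.subtype_injective)

lemma lTensor_inj_of_flat_quot (a : Ideal R) (G : Type u) [AddCommGroup G] [Module R G]
    [Module (R ⧸ a) G] [IsScalarTower R (R ⧸ a) G] [Module.Flat (R ⧸ a) G]
    {K F : Type u} [AddCommGroup K] [Module R K] [AddCommGroup F] [Module R F]
    (f : K →ₗ[R] F) (hf : Function.Injective (f.rTensor (R ⧸ a))) :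
    Function.Injective (f.lTensor G) := by
  have h1 : Function.Injective (f.baseChange (R ⧸ a)) := by
    have : Function.Injective (f.lTensor (R ⧸ a)) :=
      (LinearMap.lTensor_inj_iff_rTensor_inj (R ⧸ a) f).2 hf
    exact this
  have h2 : Function.Injective ((f.baseChange (R ⧸ a)).lTensor G) :=
    Module.Flat.lTensor_preserves_injective_linearMap _ h1
  let eK := TensorProduct.AlgebraTensorModule.cancelBaseChange R (R ⧸ a) (R ⧸ a) G K
  let eF := TensorProduct.AlgebraTensorModule.cancelBaseChange R (R ⧸ a) (R ⧸ a) G F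
  have hcomm : ∀ x, f.lTensor G x = eF ((f.baseChange (R ⧸ a)).lTensor G (eK.symm x)) := by
    intro x
    induction x with
    | zero => simp
    | tmul x e => simp [eK, eF]
    | add x y hx hy => simp only [map_add, hx, hy]
  intro x y hxy
  rw [hcomm, hcomm] at hxy
  exact eK.symm.injective (h2 (eF.injective hxy))

lemma step (a : Ideal R) (k : ℕ)
    (hflat : Module.Flat (R ⧸ a) ((↥(a ^ k)) ⧸ (a • ⊤ : Submodule R ↥(a ^ k))))
    {K F L E : Type u} [AddCommGroup K] [Module R K] [AddCommGroup F] [Module R F]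
    [AddCommGroup L] [Module R L] [AddCommGroup E] [Module R E] [Module.Flat R F]
    (f : K →ₗ[R] F) (hf : Function.Injective (f.rTensor (R ⧸ a)))
    (g : L →ₗ[R] E) (h : E →ₗ[R] K) (hh : Function.Surjective h)
    (hgh : Function.Exact g h) (y : L) (hy : g y ∈ (a ^ k • ⊤ : Submodule R E)) :
    ∃ z ∈ (a ^ k • ⊤ : Submodule R L), g (y - z) ∈ (a ^ (k + 1) • ⊤ : Submodule R E) := by
  set G := ((↥(a ^ k)) ⧸ (a • ⊤ : Submodule R ↥(a ^ k)))
  let q : ↥(a ^ k) →ₗ[R] G := Submodule.mkQ _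
  have hq : Function.Surjective q := Submodule.mkQ_surjective _
  obtain ⟨t, ht⟩ := exists_tmu _ _ _ hy
  have h1 : f.lTensor _ (h.lTensor _ t) = 0 := by
    apply tmu_inj
    rw [tmu_nat, tmu_nat, ht, hgh.apply_apply_eq_zero]; simp
  have h2 : q.rTensor K (h.lTensor _ t) = 0 := by
    apply lTensor_inj_of_flat_quot a G f hf
    rw [map_zero, ← LinearMap.comp_apply, LinearMap.lTensor_comp_rTensor,
      ← LinearMap.rTensor_comp_lTensor, LinearMap.comp_apply, h1, map_zero]
  have h3 : h.lTensor G (q.rTensor E t) = 0 := by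
    rw [← h2, ← LinearMap.comp_apply, ← LinearMap.comp_apply, LinearMap.lTensor_comp_rTensor,
      LinearMap.rTensor_comp_lTensor]
  obtain ⟨s2, hs2⟩ := (lTensor_exact G hgh hh _).1 h3
  obtain ⟨s, rfl⟩ := LinearMap.rTensor_surjective L hq s2
  have h4 : q.rTensor E (t - g.lTensor _ s) = 0 := by
    rw [map_sub, ← hs2, sub_eq_zero, ← LinearMap.comp_apply, ← LinearMap.comp_apply,
      LinearMap.lTensor_comp_rTensor, LinearMap.rTensor_comp_lTensor]
  obtain ⟨w, hw⟩ := (rTensor_exact E (LinearMap.exact_subtype_mkQ (a • ⊤ : Submodule R ↥(a ^ k))) hq _).1 h4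
  refine ⟨tmu _ _ s, tmu_mem _ _ _, ?_⟩
  have h5 : g (y - tmu _ _ s) = tmu _ _ (t - g.lTensor _ s) := by
    rw [map_sub, map_sub, ht, tmu_nat]
  rw [h5, ← hw]
  clear h5 hw
  induction w with
  | zero => simp
  | add x y hx hy => rw [map_add, map_add]; exact add_mem hx hy
  | tmul x e =>
    rw [LinearMap.rTensor_tmul, tmu_tmul]
    refine Submodule.smul_mem_smul ?_ (Submodule.mem_top (x := e))
    have := Submodule.mem_map_of_mem (f := (a ^ k).subtype) x.2
    rw [Submodule.map_smul''] at this
    simpa [pow_succ', smul_eq_mul] using this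

lemma rTensor_quot_inj_iff (a : Ideal R) {L E : Type u} [AddCommGroup L] [Module R L]
    [AddCommGroup E] [Module R E] (g : L →ₗ[R] E)
    (H : ∀ y, g y ∈ (a • ⊤ : Submodule R E) → y ∈ (a • ⊤ : Submodule R L)) :
    Function.Injective (g.rTensor (R ⧸ a)) := by
  rw [injective_iff_map_eq_zero]
  intro x hx
  obtain ⟨y2, rfl⟩ := (tensorQuotEquivQuotSMul L a).symm.surjective x
  obtain ⟨y, rfl⟩ := Submodule.Quotient.mk_surjective _ y2
  rw [← EmbeddingLike.map_eq_zero_iff (f := tensorQuotEquivQuotSMul E a)] at hx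
  rw [tensorQuotEquivQuotSMul_symm_mk, LinearMap.rTensor_tmul] at hx
  erw [tensorQuotEquivQuotSMul_tmul_mk] at hx
  rw [one_smul, Submodule.Quotient.mk_eq_zero] at hx
  rw [(Submodule.Quotient.mk_eq_zero _).2 (H _ hx), map_zero]

lemma core [IsNoetherianRing R] (a : Ideal R)
    (hflat : ∀ k : ℕ, 0 < k →
      Module.Flat (R ⧸ a) ((↥(a ^ k)) ⧸ (a • ⊤ : Submodule R ↥(a ^ k))))
    {K F L E : Type u} [AddCommGroup K] [Module R K] [AddCommGroup F] [Module R F]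
    [AddCommGroup L] [Module R L] [AddCommGroup E] [Module R E] [Module.Flat R F]
    [Module.Finite R E]
    (f : K →ₗ[R] F) (hf : Function.Injective (f.rTensor (R ⧸ a)))
    (g : L →ₗ[R] E) (h : E →ₗ[R] K) (hg : Function.Injective g) (hh : Function.Surjective h)
    (hgh : Function.Exact g h) : Function.Injective (g.rTensor (R ⧸ a)) := by
  apply rTensor_quot_inj_iff
  intro y hy
  have key : ∀ k : ℕ, ∃ z ∈ (a • ⊤ : Submodule R L),
      g (y - z) ∈ (a ^ (k + 1) • ⊤ : Submodule R E) := by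
    intro k
    induction k with
    | zero => exact ⟨0, zero_mem _, by simpa using hy⟩
    | succ k ih =>
      obtain ⟨z, hz, hyz⟩ := ih
      obtain ⟨z2, hz2, hyz2⟩ := step a (k + 1) (hflat _ k.succ_pos) f hf g h hh hgh _ hyz
      exact ⟨z + z2, add_mem hz (Submodule.smul_mono_left (Ideal.pow_le_self k.succ_ne_zero) hz2),
        by rwa [← sub_sub]⟩
  obtain ⟨k, hk⟩ := Ideal.exists_pow_inf_eq_pow_smul a (LinearMap.range g)
  obtain ⟨z, hz, hyz⟩ := key k
  have h1 : g (y - z) ∈ a ^ (k + 1) • ⊤ ⊓ LinearMap.range g := ⟨hyz, _, rfl⟩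
  rw [hk _ k.le_succ, Nat.succ_sub (le_refl _), Nat.sub_self, pow_one] at h1
  have h2 : g (y - z) ∈ a • LinearMap.range g := Submodule.smul_mono le_rfl inf_le_right h1
  rw [← Submodule.map_top, ← Submodule.map_smul''] at h2
  obtain ⟨w, hw, hgw⟩ := h2
  rw [hg hgw] at hw
  simpa using add_mem hw hz

end core

section cat
variable {R : Type u} [CommRing R]

lemma natTrans_homology_zero {A B : ModuleCat.{u} R ⥤ ModuleCat.{u} R} [A.Additive] [B.Additive]
    (α : A ⟶ B) {Y : ModuleCat.{u} R} (P : ProjectiveResolution Y) :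
    HomologicalComplex.homologyMap ((NatTrans.mapHomologicalComplex α _).app P.complex) 0 ≫
      (ChainComplex.isoHomologyι₀ ((B.mapHomologicalComplex _).obj P.complex)).hom ≫
        P.fromLeftDerivedZero' B =
    ((ChainComplex.isoHomologyι₀ ((A.mapHomologicalComplex _).obj P.complex)).hom ≫
        P.fromLeftDerivedZero' A) ≫ α.app Y := by
  have h2 : HomologicalComplex.opcyclesMap
      ((NatTrans.mapHomologicalComplex α (ComplexShape.down ℕ)).app P.complex) 0 ≫
        P.fromLeftDerivedZero' B = P.fromLeftDerivedZero' A ≫ α.app Y := by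
    rw [← cancel_epi (HomologicalComplex.pOpcycles _ _)]
    have h3 := α.naturality (P.π.f 0)
    rw [HomologicalComplex.p_opcyclesMap_assoc, P.pOpcycles_comp_fromLeftDerivedZero',
     P.pOpcycles_comp_fromLeftDerivedZero'_assoc]
    exact h3.symm
  rw [Category.assoc, ← h2]
  simp

lemma tor_flat_aux (F Y : ModuleCat.{u} R) [Module.Flat R F] (P : ProjectiveResolution Y) (n : ℕ) :
    IsZero (((((tensoringLeft (ModuleCat.{u} R)).obj F).mapHomologicalComplex _).obj
      P.complex).homology (n + 1)) := by
  rw [← HomologicalComplex.exactAt_iff_isZero_homology]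
  have := P.complex_exactAt_succ n
  rw [HomologicalComplex.exactAt_iff' _ (n + 2) (n + 1) n (by simp) (by simp)] at this ⊢
  have h := Module.Flat.lTensor_shortComplex_exact F _ this
  exact h

variable {K F M : Type u} [AddCommGroup K] [Module R K] [AddCommGroup F] [Module R F]
    [AddCommGroup M] [Module R M] (f : K →ₗ[R] F) (g : F →ₗ[R] M)

/-- `K ⊗ P → F ⊗ P → M ⊗ P`. -/
noncomputable def tseq (hfg : Function.Exact f g) (P : ChainComplex (ModuleCat.{u} R) ℕ) :
    ShortComplex (ChainComplex (ModuleCat.{u} R) ℕ) :=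
  ShortComplex.mk
    ((NatTrans.mapHomologicalComplex ((tensoringLeft (ModuleCat.{u} R)).map (ModuleCat.ofHom f)) _).app P)
    ((NatTrans.mapHomologicalComplex ((tensoringLeft (ModuleCat.{u} R)).map (ModuleCat.ofHom g)) _).app P)
    (by
      rw [← NatTrans.comp_app, ← NatTrans.mapHomologicalComplex_comp, ← Functor.map_comp,
        ← ModuleCat.ofHom_comp, hfg.linearMap_comp_eq_zero]
      ext i : 1
      simp
      rfl)

lemma tseq_shortExact (hf : Function.Injective f) (hg : Function.Surjective g)
    (hfg : Function.Exact f g) (P : ChainComplex (ModuleCat.{u} R) ℕ)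
    [∀ i, Projective (P.X i)] : (tseq f g hfg P).ShortExact := by
  apply HomologicalComplex.shortExact_of_degreewise_shortExact
  intro i
  have : Module.Projective R (P.X i) :=
    (IsProjective.iff_projective (R := R) (P.X i)).2 inferInstance
  refine ShortComplex.ShortExact.mk' ?_ ?_ ?_
  · rw [ShortComplex.ShortExact.moduleCat_exact_iff_function_exact]
    exact rTensor_exact (P.X i) hfg hg
  · rw [ModuleCat.mono_iff_injective]
    exact Module.Flat.rTensor_preserves_injective_linearMap (M := P.X i) f hf
  · rw [ModuleCat.epi_iff_surjective]
    exact LinearMap.rTensor_surjective (P.X i) hg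

lemma tor_shift [Module.Flat R F] (hf : Function.Injective f) (hg : Function.Surjective g)
    (hfg : Function.Exact f g) (Y : ModuleCat.{u} R) (n : ℕ) :
    IsZero (((Tor (ModuleCat.{u} R) (n + 2)).obj (ModuleCat.of R M)).obj Y) ↔
    IsZero (((Tor (ModuleCat.{u} R) (n + 1)).obj (ModuleCat.of R K)).obj Y) := by
  let P := projectiveResolution Y
  have hS := tseq_shortExact f g hf hg hfg P.complex
  have h0 : ∀ i, IsZero ((tseq f g hfg P.complex).X₂.homology (i + 1)) := fun i =>
    tor_flat_aux (ModuleCat.of R F) Y P i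
  exact ((P.isoLeftDerivedObj ((tensoringLeft (ModuleCat.{u} R)).obj (ModuleCat.of R M)) (n + 2)) ≪≫
    hS.δIso (n + 2) (n + 1) (by simp) (h0 _) (h0 _) ≪≫
    (P.isoLeftDerivedObj ((tensoringLeft (ModuleCat.{u} R)).obj (ModuleCat.of R K)) (n + 1)).symm).isZero_iff

lemma tor_zero_mono_iff (Y : ModuleCat.{u} R) (P : ProjectiveResolution Y) (hfg : Function.Exact f g) :
    Mono (HomologicalComplex.homologyMap (tseq f g hfg P.complex).f 0) ↔
      Function.Injective (f.rTensor Y) := by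
  let α := (tensoringLeft (ModuleCat.{u} R)).map (ModuleCat.ofHom f)
  let eK := ChainComplex.isoHomologyι₀ ((((tensoringLeft (ModuleCat.{u} R)).obj (ModuleCat.of R K)).mapHomologicalComplex _).obj P.complex) ≪≫
    asIso (P.fromLeftDerivedZero' ((tensoringLeft (ModuleCat.{u} R)).obj (ModuleCat.of R K)))
  let eF := ChainComplex.isoHomologyι₀ ((((tensoringLeft (ModuleCat.{u} R)).obj (ModuleCat.of R F)).mapHomologicalComplex _).obj P.complex) ≪≫
    asIso (P.fromLeftDerivedZero' ((tensoringLeft (ModuleCat.{u} R)).obj (ModuleCat.of R F)))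
  have key : HomologicalComplex.homologyMap (tseq f g hfg P.complex).f 0 ≫ eF.hom =
      eK.hom ≫ α.app Y := by
    exact natTrans_homology_zero α P
  have h1 : Function.Injective (f.rTensor Y) ↔ Mono (α.app Y) := by
    rw [ModuleCat.mono_iff_injective]; rfl
  rw [h1]
  have := (MorphismProperty.monomorphisms (ModuleCat.{u} R)).arrow_mk_iso_iff (Arrow.isoMk eK eF key.symm)
  exact this

lemma tor_one [Module.Flat R F] (hf : Function.Injective f) (hg : Function.Surjective g)
    (hfg : Function.Exact f g) (Y : ModuleCat.{u} R) :
    IsZero (((Tor (ModuleCat.{u} R) 1).obj (ModuleCat.of R M)).obj Y) ↔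
    Function.Injective (f.rTensor Y) := by
  let P := projectiveResolution Y
  have hS := tseq_shortExact f g hf hg hfg P.complex
  have h0 : IsZero ((tseq f g hfg P.complex).X₂.homology 1) :=
    tor_flat_aux (ModuleCat.of R F) Y P 0
  rw [← tor_zero_mono_iff f g Y P hfg]
  refine (P.isoLeftDerivedObj ((tensoringLeft (ModuleCat.{u} R)).obj (ModuleCat.of R M)) 1).isZero_iff.trans ?_
  have hm := hS.mono_δ 1 0 (by simp) h0
  have he := hS.homology_exact₁ 1 0 (by simp)
  rw [he.mono_g_iff]
  constructor
  · intro h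
    exact h.eq_of_src _ _
  · intro h
    change IsZero ((tseq f g hfg P.complex).X₃.homology 1)
    rw [IsZero.iff_id_eq_zero, ← cancel_mono (hS.δ 1 0 rfl)]
    simpa using h

end cat

theorem main_aux {R : Type u} [CommRing R] [IsNoetherianRing R] (a : Ideal R)
    (hflat : ∀ n : ℕ, 0 < n →
      Module.Flat (R ⧸ a) ((↥(a ^ n)) ⧸ (a • ⊤ : Submodule R ↥(a ^ n)))) (n : ℕ) :
    ∀ (M : Type u) [AddCommGroup M] [Module R M], Module.Finite R M →
        IsZero (((Tor (ModuleCat.{u} R) (n + 1)).obj (ModuleCat.of R M)).obj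
          (ModuleCat.of R (R ⧸ a))) →
        IsZero (((Tor (ModuleCat.{u} R) (n + 2)).obj (ModuleCat.of R M)).obj
            (ModuleCat.of R (R ⧸ a))) := by
  induction n with
  | zero =>
    intro M _ _ hM h
    obtain ⟨r, p, hp⟩ := Module.Finite.exists_fin' R M
    obtain ⟨s, p2, hp2⟩ := Module.Finite.exists_fin' R (LinearMap.ker p)
    rw [tor_shift _ p (LinearMap.ker p).subtype_injective hp (LinearMap.exact_subtype_ker_map p),
      tor_one _ p2 (LinearMap.ker p2).subtype_injective hp2 (LinearMap.exact_subtype_ker_map p2)]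
    rw [tor_one _ p (LinearMap.ker p).subtype_injective hp (LinearMap.exact_subtype_ker_map p)] at h
    exact core a hflat _ h _ p2 (LinearMap.ker p2).subtype_injective hp2
      (LinearMap.exact_subtype_ker_map p2)
  | succ n ih =>
    intro M _ _ hM h
    obtain ⟨r, p, hp⟩ := Module.Finite.exists_fin' R M
    rw [tor_shift _ p (LinearMap.ker p).subtype_injective hp
      (LinearMap.exact_subtype_ker_map p)] at h ⊢
    exact ih _ inferInstance h

end helpers


/-- Let `R` be a complete local Noetherian ring and `a` a proper ideal
such that `R` is normally flat along `a`, i.e. each `a^n/a^{n+1}` is flat as an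
`R/a`-module.  Then `R/a` is Tor-rigid as an `R`-module: for every finitely generated
`R`-module `M` and every `n > 0`, `Tor_n^R(M, R/a) = 0` implies `Tor_m^R(M, R/a) = 0`
for all `m ≥ n`. -/
theorem tor_rigid_of_normally_flat
    {R : Type u} [CommRing R] [IsNoetherianRing R] [IsLocalRing R]
    (hcomplete : IsAdicComplete (IsLocalRing.maximalIdeal R) R)
    (a : Ideal R) (ha : a ≠ ⊤)
    (hflat : ∀ n : ℕ, 0 < n →
      Module.Flat (R ⧸ a) ((↥(a ^ n)) ⧸ (a • ⊤ : Submodule R ↥(a ^ n)))) :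
    ∀ (M : Type u) [AddCommGroup M] [Module R M], Module.Finite R M →
      ∀ n : ℕ, 0 < n →
        Limits.IsZero (((Tor (ModuleCat.{u} R) n).obj (ModuleCat.of R M)).obj
          (ModuleCat.of R (R ⧸ a))) →
        ∀ m : ℕ, n ≤ m →
          Limits.IsZero (((Tor (ModuleCat.{u} R) m).obj (ModuleCat.of R M)).obj
            (ModuleCat.of R (R ⧸ a))) := by
  intro M _ _ hM n hn h m hm
  obtain ⟨n, rfl⟩ := Nat.exists_eq_succ_of_ne_zero (Nat.pos_iff_ne_zero.1 hn)
  induction m, hm using Nat.le_induction with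
  | base => exact h
  | succ m hm ih =>
    obtain ⟨m, rfl⟩ := Nat.exists_eq_succ_of_ne_zero (show m ≠ 0 by omega)
    exact main_aux a hflat m M hM ih
end

section
/- Let R be a local ring and a an ideal generated by an R-regular sequence. Then for every n > 0 the R/a-module a^n/a^{n+1} is free. Consequently, if R is complete local Noetherian, R/a is Tor-rigid as an R-module. -/
open CategoryTheory
universe u

namespace ConormalAux

/-- elementwise form of the freeness of `I^n / I^(n+1)` over `R/I`. -/
def QB {R : Type u} [CommRing R] (I : Ideal R) (n : ℕ) : Prop :=
  ∃ (k : ℕ) (e : Fin k → R), (∀ i, e i ∈ I ^ n) ∧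
    (∀ r ∈ I ^ n, ∃ c : Fin k → R, r - ∑ i, c i * e i ∈ I ^ (n + 1)) ∧
    (∀ c : Fin k → R, ∑ i, c i * e i ∈ I ^ (n + 1) → ∀ i, c i ∈ I)

variable {R : Type u} [CommRing R]

lemma QB_zero (I : Ideal R) : QB I 0 :=
  ⟨1, fun _ => 1, by simp, fun r _ => ⟨fun _ => r, by simp⟩, fun c h i => by
    have : i = 0 := Subsingleton.elim _ _
    subst this
    simpa using h⟩

lemma regular_pow {I : Ideal R} (h : ∀ n, QB I n) {x : R}
    (hx : ∀ r, x * r ∈ I → r ∈ I) (n : ℕ) : ∀ r, x * r ∈ I ^ n → r ∈ I ^ n := by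
  induction n with
  | zero => simp
  | succ n ih =>
    intro r hr
    have h1 : r ∈ I ^ n := ih r (Ideal.pow_le_pow_right (Nat.le_succ n) hr)
    obtain ⟨k, e, he, hs, hi⟩ := h n
    obtain ⟨c, hc⟩ := hs r h1
    have h2 : ∑ i, (x * c i) * e i ∈ I ^ (n + 1) := by
      have : ∑ i, (x * c i) * e i = x * r - x * (r - ∑ i, c i * e i) := by
        rw [mul_sub, Finset.mul_sum]; simp [mul_assoc]
      rw [this]
      exact sub_mem hr (Ideal.mul_mem_left _ _ hc)
    have h3 := fun i => hx _ (hi _ h2 i)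
    have : r = (r - ∑ i, c i * e i) + ∑ i, c i * e i := by ring
    rw [this, pow_succ'] at *
    refine add_mem hc (Ideal.sum_mem _ fun i _ => Ideal.mul_mem_mul (h3 i) (he i))

lemma sup_pow_succ (I : Ideal R) (x : R) (n : ℕ) (r : R)
    (hr : r ∈ (I ⊔ Ideal.span {x}) ^ (n + 1)) :
    ∃ u ∈ I ^ (n + 1), ∃ v ∈ (I ⊔ Ideal.span {x}) ^ n, r = u + x * v := by
  have key : ∀ n, (I ⊔ Ideal.span {x}) ^ (n + 1) ≤
      I ^ (n + 1) ⊔ Ideal.span {x} * (I ⊔ Ideal.span {x}) ^ n := by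
    intro n
    induction n with
    | zero => simp
    | succ n ih =>
      rw [pow_succ' _ (n + 1), Ideal.sup_mul]
      refine sup_le ?_ le_sup_right
      refine (Ideal.mul_mono_right ih).trans ?_
      rw [Ideal.mul_sup, ← pow_succ']
      refine sup_le le_sup_left (le_trans ?_ le_sup_right)
      rw [mul_left_comm, pow_succ']
      exact Ideal.mul_mono_right (Ideal.mul_mono_left le_sup_left)
  obtain ⟨u, hu, w, hw, rfl⟩ := Submodule.mem_sup.1 (key n hr)
  obtain ⟨v, hv, rfl⟩ := Ideal.mem_span_singleton_mul.1 hw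
  exact ⟨u, hu, v, hv, rfl⟩

lemma QB_step {I : Ideal R} (h : ∀ n, QB I n) {x : R}
    (hx : ∀ r, x * r ∈ I → r ∈ I) (n : ℕ) : QB (I ⊔ Ideal.span {x}) n := by
  induction n with
  | zero => exact QB_zero _
  | succ n ih =>
    set J := I ⊔ Ideal.span {x} with hJ
    have hIJ : I ≤ J := le_sup_left
    have hxJ : x ∈ J := Ideal.mem_sup_right (Ideal.mem_span_singleton_self x)
    obtain ⟨k, e, he, hes, hei⟩ := h (n + 1)
    obtain ⟨l, f, hf, hfs, hfi⟩ := ih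
    refine ⟨k + l, Fin.append e (fun j => x * f j), ?_, ?_, ?_⟩
    · intro i
      refine Fin.addCases (fun i => ?_) (fun i => ?_) i
      · simpa using Ideal.pow_right_mono hIJ _ (he i)
      · simpa [pow_succ'] using Ideal.mul_mem_mul hxJ (hf i)
    · intro r hr
      obtain ⟨u, hu, v, hv, rfl⟩ := sup_pow_succ I x n r hr
      obtain ⟨c, hc⟩ := hes u hu
      obtain ⟨d, hd⟩ := hfs v hv
      refine ⟨Fin.append c d, ?_⟩
      rw [Fin.sum_univ_add]
      simp only [Fin.append_left, Fin.append_right]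
      have : u + x * v - (∑ i, c i * e i + ∑ j, d j * (x * f j)) =
          (u - ∑ i, c i * e i) + x * (v - ∑ j, d j * f j) := by
        rw [mul_sub, Finset.mul_sum]
        simp only [mul_left_comm x]
        ring
      rw [this]
      refine add_mem (Ideal.pow_right_mono hIJ _ hc) ?_
      rw [pow_succ' _ (n + 1)]
      exact Ideal.mul_mem_mul hxJ hd
    · intro c hc
      rw [Fin.sum_univ_add] at hc
      simp only [Fin.append_left, Fin.append_right] at hc
      set a := fun i => c (Fin.castAdd l i) with ha
      set b := fun j => c (Fin.natAdd k j) with hb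
      obtain ⟨u', hu', v', hv', hE⟩ := sup_pow_succ I x (n + 1) _ hc
      set u := ∑ i, a i * e i with hu
      set v := ∑ j, b j * f j with hv
      have hE2 : u + x * v = u' + x * v' := by
        rw [← hE, hu, hv, Finset.mul_sum]
        simp only [mul_left_comm x, ha, hb]
      have huI : u ∈ I ^ (n + 1) := Ideal.sum_mem _ fun i _ => Ideal.mul_mem_left _ _ (he i)
      have hw : v - v' ∈ I ^ (n + 1) := by
        refine regular_pow h hx _ _ ?_
        have : x * (v - v') = u' - u := by linear_combination hE2
        rw [this]
        exact sub_mem (Ideal.pow_le_pow_right (Nat.le_succ _) hu') huI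
      have hvJ : v ∈ J ^ (n + 1) := by
        have : v = (v - v') + v' := by ring
        rw [this]
        exact add_mem (Ideal.pow_right_mono hIJ _ hw) hv'
      obtain ⟨g, hg⟩ := hes _ hw
      have h4 : ∑ i, (a i + x * g i) * e i ∈ I ^ (n + 1 + 1) := by
        have : ∑ i, (a i + x * g i) * e i = u' - x * ((v - v') - ∑ i, g i * e i) := by
          simp only [add_mul, Finset.sum_add_distrib, mul_assoc, ← Finset.mul_sum]
          linear_combination hE2
        rw [this]
        exact sub_mem hu' (Ideal.mul_mem_left _ _ hg)
      have h5 := hei _ h4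
      have h6 := hfi _ hvJ
      intro i
      refine Fin.addCases (fun i => ?_) (fun j => ?_) i
      · have := sub_mem (hIJ (h5 i)) (Ideal.mul_mem_right (g i) J hxJ)
        simpa [ha] using this
      · exact h6 j

lemma QB_free {I : Ideal R} {n : ℕ} (h : QB I n) :
    Module.Free (R ⧸ I) ((↥(I ^ n)) ⧸ (I • ⊤ : Submodule R ↥(I ^ n))) := by
  obtain ⟨k, e, he, hs, hi⟩ := h
  have hmem : ∀ y : ↥(I ^ n), y ∈ (I • ⊤ : Submodule R ↥(I ^ n)) ↔ (y : R) ∈ I ^ (n + 1) := by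
    intro y
    rw [Submodule.mem_smul_top_iff, smul_eq_mul, pow_succ']
  let b : Fin k → ((↥(I ^ n)) ⧸ (I • ⊤ : Submodule R ↥(I ^ n))) :=
    fun i => Submodule.Quotient.mk ⟨e i, he i⟩
  have hcomb : ∀ c : Fin k → R, ∑ i, (Ideal.Quotient.mk I (c i)) • b i =
      Submodule.Quotient.mk (∑ i, c i • (⟨e i, he i⟩ : ↥(I ^ n))) := by
    intro c
    rw [← Submodule.mkQ_apply, map_sum]
    rfl
  have li : LinearIndependent (R ⧸ I) b := by
    rw [Fintype.linearIndependent_iff]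
    intro g hg
    choose c hc using fun i => Ideal.Quotient.mk_surjective (g i)
    obtain rfl : (fun i => Ideal.Quotient.mk I (c i)) = g := funext hc
    rw [hcomb, Submodule.Quotient.mk_eq_zero, hmem] at hg
    intro i
    refine Ideal.Quotient.eq_zero_iff_mem.2 (hi c ?_ i)
    simpa using hg
  have sp : ⊤ ≤ Submodule.span (R ⧸ I) (Set.range b) := by
    rintro y -
    obtain ⟨y, rfl⟩ := Submodule.Quotient.mk_surjective _ y
    obtain ⟨c, hc⟩ := hs y y.2
    have : Submodule.Quotient.mk y = ∑ i, (Ideal.Quotient.mk I (c i)) • b i := by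
      rw [hcomb, Submodule.Quotient.eq, hmem]
      simpa using hc
    rw [this]
    exact Submodule.sum_mem _ fun i _ => Submodule.smul_mem _ _ (Submodule.subset_span ⟨i, rfl⟩)
  exact Module.Free.of_basis (Module.Basis.mk li sp)

lemma reg_last {rs : List R} {x : R}
    (h : RingTheory.Sequence.IsWeaklyRegular R (rs ++ [x])) :
    RingTheory.Sequence.IsWeaklyRegular R rs ∧
      ∀ r, x * r ∈ Ideal.ofList rs → r ∈ Ideal.ofList rs := by
  rw [RingTheory.Sequence.isWeaklyRegular_append_iff] at h
  refine ⟨h.1, fun r hr => ?_⟩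
  have h2 := ((RingTheory.Sequence.isWeaklyRegular_singleton_iff _ _).1 h.2)
  have h3 := (isSMulRegular_iff_right_eq_zero_of_smul.1 h2) (Submodule.Quotient.mk r) (by
    rw [← Submodule.Quotient.mk_smul, Submodule.Quotient.mk_eq_zero]
    simpa using hr)
  rw [Submodule.Quotient.mk_eq_zero] at h3
  simpa using h3

lemma QB_all (rs : List R) (h : RingTheory.Sequence.IsWeaklyRegular R rs) :
    ∀ n, QB (Ideal.ofList rs) n := by
  induction rs using List.reverseRecOn with
  | nil =>
    intro n
    cases n with
    | zero => exact QB_zero _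
    | succ n =>
      refine ⟨0, fun _ => 0, by simp, fun r hr => ⟨0, ?_⟩, fun c _ i => i.elim0⟩
      simpa [pow_succ] using hr
  | append_singleton rs x ih =>
    obtain ⟨h1, h2⟩ := reg_last h
    rw [Ideal.ofList_append, Ideal.ofList_singleton]
    exact QB_step (ih h1) h2

/-- terms of the mapping cone of multiplication by an element -/
def coneX (X : ℕ → ModuleCat.{u} R) : ℕ → ModuleCat.{u} R
  | 0 => X 0
  | n + 1 => ModuleCat.of R (X n × X (n + 1))

/-- differentials of the mapping cone of multiplication by `x` -/
def coned (x : R) (X : ℕ → ModuleCat.{u} R) (d : ∀ n, X (n + 1) →ₗ[R] X n) :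
    ∀ n, coneX X (n + 1) →ₗ[R] coneX X n
  | 0 => (x • LinearMap.fst R (X 0) (X 1) + d 0 ∘ₗ LinearMap.snd R (X 0) (X 1) :
      (X 0 × X 1) →ₗ[R] X 0)
  | n + 1 => (LinearMap.prod (-(d n ∘ₗ LinearMap.fst R (X (n + 1)) (X (n + 2))))
      (x • LinearMap.fst R (X (n + 1)) (X (n + 2)) +
        d (n + 1) ∘ₗ LinearMap.snd R (X (n + 1)) (X (n + 2))) :
      (X (n + 1) × X (n + 2)) →ₗ[R] (X n × X (n + 1)))

lemma coned_zero (x : R) (X : ℕ → ModuleCat.{u} R) (d : ∀ n, X (n + 1) →ₗ[R] X n)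
    (p : X 0) (q : X 1) :
    coned x X d 0 ((p, q) : X 0 × X 1) = (x • p + d 0 q : X 0) := rfl

lemma coned_succ (x : R) (X : ℕ → ModuleCat.{u} R) (d : ∀ n, X (n + 1) →ₗ[R] X n) (n : ℕ)
    (p : X (n + 1)) (q : X (n + 2)) :
    coned x X d (n + 1) ((p, q) : X (n + 1) × X (n + 2)) =
      ((-(d n p), x • p + d (n + 1) q) : X n × X (n + 1)) := rfl

section
variable (x : R) (X : ℕ → ModuleCat.{u} R) (d : ∀ n, X (n + 1) →ₗ[R] X n)

lemma coned_coned (hd : ∀ n y, d n (d (n + 1) y) = 0) (n : ℕ) (y : coneX X (n + 2)) :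
    coned x X d n (coned x X d (n + 1) y) = 0 := by
  obtain ⟨p, q⟩ : X (n + 1) × X (n + 2) := y
  rw [coned_succ]
  cases n with
  | zero =>
    rw [coned_zero]
    simp [hd]
    rfl
  | succ n =>
    rw [coned_succ]
    simp only [map_neg, hd, map_add, map_smul, smul_neg]
    simp
    rfl

/-- the cone is exact in degree `n+2` when the complex is exact in degrees `n+1`, `n+2` -/
lemma cone_exact_succ (hd : ∀ n y, d n (d (n + 1) y) = 0) (n : ℕ)
    (h1 : Function.Exact (d (n + 1)) (d n)) (h2 : Function.Exact (d (n + 2)) (d (n + 1))) :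
    Function.Exact (coned x X d (n + 2)) (coned x X d (n + 1)) := by
  intro y
  constructor
  · intro hy
    obtain ⟨p, q⟩ : X (n + 1) × X (n + 2) := y
    rw [coned_succ] at hy
    have hy1 : -(d n p) = 0 := congrArg Prod.fst hy
    have hy2 : x • p + d (n + 1) q = 0 := congrArg Prod.snd hy
    obtain ⟨p', rfl⟩ := (h1 p).1 (by simpa using hy1)
    obtain ⟨q', hq'⟩ := (h2 (x • p' + q)).1 (by simpa using hy2)
    refine ⟨((-p', q') : X (n + 2) × X (n + 3)), ?_⟩
    rw [coned_succ, hq']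
    simp
    rfl
  · rintro ⟨z, rfl⟩
    exact coned_coned x X d hd _ z

lemma cone_exact_one (hd : ∀ n y, d n (d (n + 1) y) = 0)
    (h0 : ∀ p, x • p ∈ LinearMap.range (d 0) → p ∈ LinearMap.range (d 0))
    (h1 : Function.Exact (d 1) (d 0)) :
    Function.Exact (coned x X d 1) (coned x X d 0) := by
  intro y
  constructor
  · intro hy
    obtain ⟨p, q⟩ : X 0 × X 1 := y
    rw [coned_zero] at hy
    obtain ⟨p', rfl⟩ := h0 p ⟨-q, by rw [map_neg]; exact (eq_neg_of_add_eq_zero_left hy).symm⟩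
    obtain ⟨q', hq'⟩ := (h1 (x • p' + q)).1 (by
      rw [map_add, map_smul]; exact hy)
    refine ⟨((-p', q') : X 1 × X 2), ?_⟩
    rw [coned_succ, hq']
    simp
    rfl
  · rintro ⟨z, rfl⟩
    exact coned_coned x X d hd _ z

/-- exactness of the cone implies exactness of the complex, by Nakayama. -/
lemma exact_of_cone [IsNoetherianRing R] [IsLocalRing R]
    (hx : x ∈ IsLocalRing.maximalIdeal R) (hd : ∀ n y, d n (d (n + 1) y) = 0) (n : ℕ)
    [Module.Finite R (X (n + 1))]
    (h : Function.Exact (coned x X d (n + 1)) (coned x X d n)) :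
    Function.Exact (d (n + 1)) (d n) := by
  have key : LinearMap.ker (d n) ≤ LinearMap.range (d (n + 1)) := by
    refine Submodule.le_of_le_smul_of_le_jacobson_bot (I := IsLocalRing.maximalIdeal R)
      (IsNoetherian.noetherian _) (IsLocalRing.maximalIdeal_le_jacobson _) ?_
    intro z hz
    have hz' : d n z = 0 := hz
    have : coned x X d n ((0, z) : X n × X (n + 1)) = 0 := by
      cases n with
      | zero => rw [coned_zero, hz']; simp; rfl
      | succ n => rw [coned_succ, hz']; simp; rfl
    obtain ⟨⟨p, q⟩, hpq⟩ : ∃ y : X (n + 1) × X (n + 2), _ := (h _).1 this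
    rw [coned_succ] at hpq
    have h1 : -(d n p) = 0 := congrArg Prod.fst hpq
    have h2 : x • p + d (n + 1) q = z := congrArg Prod.snd hpq
    rw [← h2, add_comm (x • p)]
    exact Submodule.add_mem_sup ⟨q, rfl⟩ (Submodule.smul_mem_smul hx (by simpa using h1))
  intro z
  exact ⟨fun hz => key hz, by rintro ⟨y, rfl⟩; exact hd n y⟩

open TensorProduct

/-- tensoring the terms with `M` -/
abbrev tX (M : Type u) [AddCommGroup M] [Module R M] : ℕ → ModuleCat.{u} R :=
  fun n => ModuleCat.of R (M ⊗[R] X n)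

/-- tensoring the differentials with `M` -/
abbrev td (M : Type u) [AddCommGroup M] [Module R M] :
    ∀ n, tX X M (n + 1) →ₗ[R] tX X M n :=
  fun n => (d n).lTensor M

/-- the cone commutes with tensor products -/
noncomputable def coneEquiv (M : Type u) [AddCommGroup M] [Module R M] :
    ∀ n, (M ⊗[R] coneX X n) ≃ₗ[R] coneX (tX X M) n
  | 0 => LinearEquiv.refl R _
  | n + 1 => TensorProduct.prodRight R R M (X n) (X (n + 1))

lemma coneEquiv_comm (M : Type u) [AddCommGroup M] [Module R M] (n : ℕ) :
    coned x (tX X M) (td X d M) n ∘ₗ (coneEquiv X M (n + 1)).toLinearMap =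
      (coneEquiv X M n).toLinearMap ∘ₗ (coned x X d n).lTensor M := by
  refine TensorProduct.ext' fun m y => ?_
  obtain ⟨p, q⟩ : X n × X (n + 1) := y
  show coned x (tX X M) (td X d M) n
      (((m ⊗ₜ[R] p, m ⊗ₜ[R] q) : (M ⊗[R] X n) × (M ⊗[R] X (n + 1)))) =
    coneEquiv X M n (m ⊗ₜ[R] (coned x X d n ((p, q) : X n × X (n + 1))))
  cases n with
  | zero =>
    show x • (m ⊗ₜ[R] p) + m ⊗ₜ[R] (d 0 q) = m ⊗ₜ[R] (x • p + d 0 q)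
    rw [tmul_add, tmul_smul]
  | succ n =>
    show ((-(m ⊗ₜ[R] (d n p)), x • (m ⊗ₜ[R] p) + m ⊗ₜ[R] (d (n + 1) q)) :
      (M ⊗[R] X n) × (M ⊗[R] X (n + 1))) =
      (m ⊗ₜ[R] (-(d n p)), m ⊗ₜ[R] (x • p + d (n + 1) q))
    rw [tmul_add, tmul_smul, tmul_neg]

lemma cone_tensor_exact_iff (M : Type u) [AddCommGroup M] [Module R M] (n : ℕ) :
    Function.Exact (coned x (tX X M) (td X d M) (n + 1)) (coned x (tX X M) (td X d M) n) ↔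
    Function.Exact ((coned x X d (n + 1)).lTensor M) ((coned x X d n).lTensor M) :=
  Function.Exact.iff_of_ladder_linearEquiv (coneEquiv_comm x X d M (n + 1))
    (coneEquiv_comm x X d M n)

end

/-- resolutions of `R/I` by finite projective modules for which rigidity holds -/
def Good (I : Ideal R) : Prop :=
  ∃ (X : ℕ → ModuleCat.{u} R) (d : ∀ n, X (n + 1) →ₗ[R] X n) (ε : X 0 →ₗ[R] (R ⧸ I)),
    (∀ n, Module.Finite R (X n)) ∧ (∀ n, Module.Projective R (X n)) ∧
    (∀ n, Function.Exact (d (n + 1)) (d n)) ∧ Function.Exact (d 0) ε ∧ Function.Surjective ε ∧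
    ∀ (M : Type u) [AddCommGroup M] [Module R M], Module.Finite R M → ∀ n,
      Function.Exact ((d (n + 1)).lTensor M) ((d n).lTensor M) →
      Function.Exact ((d (n + 2)).lTensor M) ((d (n + 1)).lTensor M)

/-- terms of the trivial resolution -/
def trivX (R : Type u) [CommRing R] : ℕ → ModuleCat.{u} R
  | 0 => ModuleCat.of R R
  | _ + 1 => ModuleCat.of R PUnit

instance (n : ℕ) : Subsingleton (trivX R (n + 1)) := inferInstanceAs (Subsingleton PUnit)

lemma good_bot : Good (⊥ : Ideal R) := by
  refine ⟨trivX R, fun _ => 0, Submodule.mkQ _, ?_, ?_, ?_, ?_, ?_, ?_⟩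
  · rintro (_ | n)
    · exact inferInstanceAs (Module.Finite R R)
    · exact inferInstanceAs (Module.Finite R PUnit.{u + 1})
  · rintro (_ | n)
    · exact inferInstanceAs (Module.Projective R R)
    · exact inferInstanceAs (Module.Projective R PUnit.{u + 1})
  · intro n y
    exact ⟨fun _ => ⟨0, Subsingleton.elim _ _⟩, fun _ => rfl⟩
  · intro (y : R)
    have : (Submodule.mkQ (⊥ : Ideal R)) y = 0 ↔ y = 0 := by
      rw [Submodule.mkQ_apply, Submodule.Quotient.mk_eq_zero, Submodule.mem_bot]
    refine this.trans ⟨fun h => ⟨0, h.symm⟩, fun ⟨z, hz⟩ => hz.symm⟩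
  · exact Submodule.mkQ_surjective _
  · intro M _ _ _ n _ y
    have : Subsingleton (TensorProduct R M (trivX R (n + 1 + 1))) := inferInstance
    exact ⟨fun _ => ⟨0, Subsingleton.elim _ _⟩, fun _ => by simp⟩

lemma good_step [IsNoetherianRing R] [IsLocalRing R] {I : Ideal R} (h : Good I) {x : R}
    (hx : ∀ r, x * r ∈ I → r ∈ I) (hxm : x ∈ IsLocalRing.maximalIdeal R) :
    Good (I ⊔ Ideal.span {x}) := by
  obtain ⟨X, d, ε, hfin, hproj, hex, hε, hεs, hrig⟩ := h
  have hd : ∀ n y, d n (d (n + 1) y) = 0 := fun n y => (hex n).apply_apply_eq_zero y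
  let π : (R ⧸ I) →ₗ[R] (R ⧸ (I ⊔ Ideal.span {x})) := Submodule.factor le_sup_left
  refine ⟨coneX X, coned x X d, π ∘ₗ ε, ?_, ?_, ?_, ?_, ?_, ?_⟩
  · rintro (_ | n)
    · exact hfin 0
    · have := hfin n
      have := hfin (n + 1)
      exact inferInstanceAs (Module.Finite R (X n × X (n + 1)))
  · rintro (_ | n)
    · exact hproj 0
    · have := hproj n
      have := hproj (n + 1)
      exact inferInstanceAs (Module.Projective R (X n × X (n + 1)))
  · rintro (_ | n)
    · refine cone_exact_one x X d hd (fun p hp => ?_) (hex 0)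
      have h1 : ε (x • p) = 0 := (hε _).2 hp
      refine (hε _).1 ?_
      obtain ⟨r, hr⟩ := Submodule.Quotient.mk_surjective _ (ε p)
      rw [map_smul, ← hr, ← Submodule.Quotient.mk_smul, Submodule.Quotient.mk_eq_zero] at h1
      rw [← hr, Submodule.Quotient.mk_eq_zero]
      exact hx r h1
    · exact cone_exact_succ x X d hd n (hex _) (hex _)
  · intro y
    constructor
    · intro hy
      change X 0 at y
      obtain ⟨r, hr⟩ := Submodule.Quotient.mk_surjective _ (ε y)
      have h1 : π (ε y) = 0 := hy
      rw [← hr] at h1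
      have h2 : r ∈ I ⊔ Ideal.span {x} := (Submodule.Quotient.mk_eq_zero _).1 h1
      obtain ⟨u, hu, v, hv, rfl⟩ := Submodule.mem_sup.1 h2
      obtain ⟨w, rfl⟩ := Ideal.mem_span_singleton'.1 hv
      obtain ⟨p, hp⟩ := hεs (Submodule.Quotient.mk w)
      obtain ⟨q, hq⟩ := (hε (y - x • p)).1 (by
        rw [map_sub, map_smul, hp, ← hr, ← Submodule.Quotient.mk_smul,
          ← Submodule.Quotient.mk_sub, Submodule.Quotient.mk_eq_zero]
        simpa [mul_comm] using hu)
      refine ⟨((p, q) : X 0 × X 1), ?_⟩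
      rw [coned_zero, hq]
      exact add_sub_cancel _ _
    · rintro ⟨⟨p, q⟩, rfl⟩
      show π (ε (x • p + d 0 q)) = 0
      rw [map_add, hε.apply_apply_eq_zero, add_zero]
      obtain ⟨r, hr⟩ := Submodule.Quotient.mk_surjective _ (ε p)
      rw [map_smul, ← hr, ← Submodule.Quotient.mk_smul]
      refine (Submodule.Quotient.mk_eq_zero _).2 (Ideal.mem_sup_right ?_)
      exact Ideal.mul_mem_right _ _ (Ideal.mem_span_singleton_self x)
  · exact (Submodule.factor_surjective (le_sup_left : I ≤ I ⊔ Ideal.span {x})).comp hεs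
  · intro M _ _ hM n hn
    have htd : ∀ n y, td X d M n (td X d M (n + 1) y) = 0 := by
      intro n y
      have : d n ∘ₗ d (n + 1) = 0 := LinearMap.ext (hd n)
      rw [← LinearMap.comp_apply, ← LinearMap.lTensor_comp, this]
      simp
    rw [← cone_tensor_exact_iff] at hn ⊢
    have := hfin (n + 1)
    have e1 : Function.Exact (td X d M (n + 1)) (td X d M n) :=
      exact_of_cone x (tX X M) (td X d M) hxm htd n hn
    exact cone_exact_succ x _ _ htd n e1 (hrig M hM n e1)


lemma good_all [IsNoetherianRing R] [IsLocalRing R] (rs : List R)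
    (h : RingTheory.Sequence.IsWeaklyRegular R rs)
    (hm : ∀ r ∈ rs, r ∈ IsLocalRing.maximalIdeal R) : Good (Ideal.ofList rs) := by
  induction rs using List.reverseRecOn with
  | nil => rw [Ideal.ofList_nil]; exact good_bot
  | append_singleton rs x ih =>
    obtain ⟨h1, h2⟩ := reg_last h
    rw [Ideal.ofList_append, Ideal.ofList_singleton]
    exact good_step (ih h1 fun r hr => hm r (by simp [hr])) h2 (hm x (by simp))

section
variable (X : ℕ → ModuleCat.{u} R) (d : ∀ n, X (n + 1) →ₗ[R] X n)
  (hd : ∀ n, Function.Exact (d (n + 1)) (d n))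

/-- the chain complex in `ModuleCat` -/
noncomputable def cx : ChainComplex (ModuleCat.{u} R) ℕ :=
  ChainComplex.of X (fun n => ModuleCat.ofHom (d n)) (fun n => by
    rw [← ModuleCat.ofHom_comp, (hd n).linearMap_comp_eq_zero]
    rfl)

lemma cx_d (n : ℕ) : (cx X d hd).d (n + 1) n = ModuleCat.ofHom (d n) := by
  simp [cx]

lemma cx_exactAt (n : ℕ) : (cx X d hd).ExactAt (n + 1) := by
  rw [HomologicalComplex.exactAt_iff' _ (n + 1 + 1) (n + 1) n (by simp) (by simp),
    ShortComplex.ShortExact.moduleCat_exact_iff_function_exact]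
  have e1 := cx_d X d hd n
  have e2 := cx_d X d hd (n + 1)
  show Function.Exact ((cx X d hd).d (n + 1 + 1) (n + 1)) ((cx X d hd).d (n + 1) n)
  rw [e1, e2]
  exact hd n

/-- the projective resolution -/
noncomputable def res {N : ModuleCat.{u} R} (ε : X 0 →ₗ[R] N) (hε : Function.Exact (d 0) ε)
    (hεs : Function.Surjective ε) (hp : ∀ n, Module.Projective R (X n)) :
    ProjectiveResolution N where
  complex := cx X d hd
  projective n := by
    have := hp n
    exact ModuleCat.projective_of_categoryTheory_projective (X n)
  π := (ChainComplex.toSingle₀Equiv _ _).symm ⟨ModuleCat.ofHom ε, by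
    rw [cx_d]
    show ModuleCat.ofHom (d 0) ≫ ModuleCat.ofHom ε = 0
    rw [← ModuleCat.ofHom_comp, hε.linearMap_comp_eq_zero]
    rfl⟩
  quasiIso := ⟨fun n => by
    have hz : ModuleCat.ofHom (d 0) ≫ ModuleCat.ofHom ε = 0 := by
      rw [← ModuleCat.ofHom_comp, hε.linearMap_comp_eq_zero]
      rfl
    cases n
    · rw [ChainComplex.quasiIsoAt₀_iff, ShortComplex.quasiIso_iff_of_zeros']
      · refine (ShortComplex.exact_and_epi_g_iff_of_iso
          (S₂ := ShortComplex.mk (ModuleCat.ofHom (d 0)) (ModuleCat.ofHom ε) hz) ?_).2 ⟨?_, ?_⟩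
        · exact ShortComplex.isoMk (Iso.refl _) (Iso.refl _) (Iso.refl _)
            (by
              have := cx_d X d hd 0
              refine (Category.id_comp _).trans (Eq.trans ?_ (Category.comp_id _).symm)
              exact this.symm) (by
              refine (Category.id_comp _).trans (Eq.trans ?_ (Category.comp_id _).symm)
              exact (ChainComplex.toSingle₀Equiv_symm_apply_f_zero (C := cx X d hd)
                (ModuleCat.ofHom ε) _).symm)
        · rw [ShortComplex.ShortExact.moduleCat_exact_iff_function_exact]
          exact hε
        · exact (ModuleCat.epi_iff_surjective _).2 hεs
      all_goals rfl
    · rw [quasiIsoAt_iff_exactAt']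
      · apply cx_exactAt
      · apply ChainComplex.exactAt_succ_single_obj⟩

end

lemma tor_isZero_iff {I : Ideal R} (X : ℕ → ModuleCat.{u} R) (d : ∀ n, X (n + 1) →ₗ[R] X n)
    (hd : ∀ n, Function.Exact (d (n + 1)) (d n))
    (ε : X 0 →ₗ[R] (R ⧸ I)) (hε : Function.Exact (d 0) ε)
    (hεs : Function.Surjective ε) (hp : ∀ n, Module.Projective R (X n))
    (M : Type u) [AddCommGroup M] [Module R M] (n : ℕ) :
    Limits.IsZero (((Tor (ModuleCat.{u} R) (n + 1)).obj (ModuleCat.of R M)).obj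
            (ModuleCat.of R (R ⧸ I))) ↔
      Function.Exact ((d (n + 1)).lTensor M) ((d n).lTensor M) := by
  let P := res X d hd (N := ModuleCat.of R (R ⧸ I)) ε hε hεs hp
  let F := (MonoidalCategory.tensoringLeft (ModuleCat.{u} R)).obj (ModuleCat.of R M)
  have e := P.isoLeftDerivedObj F (n + 1)
  refine (e.isZero_iff).trans ?_
  refine (HomologicalComplex.exactAt_iff_isZero_homology _ _).symm.trans ?_
  rw [HomologicalComplex.exactAt_iff' _ (n + 1 + 1) (n + 1) n (by simp) (by simp),
    ShortComplex.ShortExact.moduleCat_exact_iff_function_exact]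
  show Function.Exact (F.map ((cx X d hd).d (n + 1 + 1) (n + 1))) (F.map ((cx X d hd).d (n + 1) n)) ↔ _
  rw [cx_d, cx_d]
  rfl

end ConormalAux
/-- Let `R` be a local ring and `a` an ideal generated by an `R`-regular
sequence.  Then for every `n > 0` the `R/a`-module `a^n/a^{n+1}` is free.  Consequently,
if `R` is moreover complete local Noetherian, `R/a` is Tor-rigid as an `R`-module. -/
theorem conormal_free_of_regular_sequence_and_tor_rigid
    {R : Type u} [CommRing R] [IsLocalRing R]
    (rs : List R) (hrs : RingTheory.Sequence.IsRegular R rs)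
    (a : Ideal R) (ha : a = Ideal.span {r | r ∈ rs}) :
    (∀ n : ℕ, 0 < n →
      Module.Free (R ⧸ a) ((↥(a ^ n)) ⧸ (a • ⊤ : Submodule R ↥(a ^ n)))) ∧
    (IsNoetherianRing R → IsAdicComplete (IsLocalRing.maximalIdeal R) R →
      ∀ (M : Type u) [AddCommGroup M] [Module R M], Module.Finite R M →
        ∀ n : ℕ, 0 < n →
          Limits.IsZero (((Tor (ModuleCat.{u} R) n).obj (ModuleCat.of R M)).obj
            (ModuleCat.of R (R ⧸ a))) →
          ∀ m : ℕ, n ≤ m →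
            Limits.IsZero (((Tor (ModuleCat.{u} R) m).obj (ModuleCat.of R M)).obj
              (ModuleCat.of R (R ⧸ a)))) := by
  have ha' : a = Ideal.ofList rs := ha
  subst ha'
  refine ⟨fun n _ => ConormalAux.QB_free (ConormalAux.QB_all rs hrs.toIsWeaklyRegular n), ?_⟩
  intro hN _ M _ _ hM n hn h0 m hm
  have hproper : Ideal.ofList rs ≠ ⊤ := by
    intro h
    apply hrs.top_ne_smul
    rw [h]
    simp
  have hmax : ∀ r ∈ rs, r ∈ IsLocalRing.maximalIdeal R := fun r hr =>
    IsLocalRing.le_maximalIdeal hproper (Ideal.subset_span hr)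
  obtain ⟨X, d, ε, -, hproj, hex, hε, hεs, hrig⟩ :=
    ConormalAux.good_all rs hrs.toIsWeaklyRegular hmax
  have key := ConormalAux.tor_isZero_iff X d hex ε hε hεs hproj M
  obtain ⟨n, rfl⟩ := Nat.exists_eq_add_one_of_ne_zero hn.ne'
  obtain ⟨k, rfl⟩ := Nat.exists_eq_add_of_le hm
  rw [show n + 1 + k = (n + k) + 1 by omega, key]
  rw [key] at h0
  clear hm
  induction k with
  | zero => exact h0
  | succ k ih => exact hrig M hM _ ih
end

section
/- Let R, S, T be commutative rings with surjections R → S → T where S = R/a and T = R/b for ideals a ⊆ b, and let Γ be a Noetherian R-algebra. Assume Tor_n^S(S, T) computations are as usual and consider conditions (T1) Tor_n^R(Γ, S) = 0 for all n > 0; (T2) Tor_n^S(Γ ⊗_R S, T) = 0 for all n > 0; (T3) Tor_n^R(Γ, T) = 0 for all n > 0. Then any two of (T1), (T2), (T3) imply the third. -/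
open CategoryTheory

universe u

namespace TorAux

open MonoidalCategory

section cat
variable {A : Type u} [CommRing A]

/-- The short complex `X₁ ⊗ C → X₂ ⊗ C → X₃ ⊗ C` of chain complexes. -/
noncomputable def tsc (S : ShortComplex (ModuleCat.{u} A)) (C : ChainComplex (ModuleCat.{u} A) ℕ) :
    ShortComplex (ChainComplex (ModuleCat.{u} A) ℕ) where
  X₁ := (((tensoringLeft _).obj S.X₁).mapHomologicalComplex _).obj C
  X₂ := (((tensoringLeft _).obj S.X₂).mapHomologicalComplex _).obj C
  X₃ := (((tensoringLeft _).obj S.X₃).mapHomologicalComplex _).obj C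
  f := (NatTrans.mapHomologicalComplex ((tensoringLeft _).map S.f) _).app C
  g := (NatTrans.mapHomologicalComplex ((tensoringLeft _).map S.g) _).app C
  zero := by
    ext i : 1
    change S.f ▷ C.X i ≫ S.g ▷ C.X i = 0
    rw [← comp_whiskerRight, S.zero, MonoidalPreadditive.zero_whiskerRight]

lemma tsc_shortExact {S : ShortComplex (ModuleCat.{u} A)} (hS : S.ShortExact)
    (C : ChainComplex (ModuleCat.{u} A) ℕ) (hC : ∀ i, Projective (C.X i)) :
    (tsc S C).ShortExact := by
  apply HomologicalComplex.shortExact_of_degreewise_shortExact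
  intro i
  have := hC i
  have : Module.Projective A (C.X i) := inferInstance
  exact hS.map_of_exact (tensorRight (C.X i))

lemma tensor_exactAt (F : ModuleCat.{u} A) [Module.Flat A F]
    (C : ChainComplex (ModuleCat.{u} A) ℕ) (n : ℕ) (h : C.ExactAt n) :
    Limits.IsZero
      (((((tensoringLeft _).obj F).mapHomologicalComplex _).obj C).homology n) := by
  rw [← HomologicalComplex.exactAt_iff_isZero_homology]
  exact Module.Flat.lTensor_shortComplex_exact F (C.sc n) h

lemma resolution_exactAt {Y : ModuleCat.{u} A} (P : ProjectiveResolution Y) (n : ℕ) :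
    P.complex.ExactAt (n + 1) := P.complex_exactAt_succ n

lemma mono_H0_iff {X Z Y : ModuleCat.{u} A} (f : X ⟶ Z) (P : ProjectiveResolution Y) :
    Mono (HomologicalComplex.homologyMap
      ((NatTrans.mapHomologicalComplex ((tensoringLeft _).map f) _).app P.complex) 0) ↔
    Mono (f ▷ Y) := by
  let e (X : ModuleCat.{u} A) := ChainComplex.isoHomologyι₀
    ((((tensoringLeft _).obj X).mapHomologicalComplex _).obj P.complex) ≪≫
    @asIso _ _ _ _ (P.fromLeftDerivedZero' ((tensoringLeft _).obj X))
      (by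
        have : Limits.PreservesFiniteColimits ((tensoringLeft (ModuleCat.{u} A)).obj X) :=
          inferInstanceAs (Limits.PreservesFiniteColimits (tensorLeft X))
        infer_instance)
  have h : HomologicalComplex.homologyMap
      ((NatTrans.mapHomologicalComplex ((tensoringLeft _).map f) _).app P.complex) 0 ≫ (e Z).hom
      = (e X).hom ≫ f ▷ Y := by
    have h1 : HomologicalComplex.opcyclesMap
        ((NatTrans.mapHomologicalComplex ((tensoringLeft _).map f) _).app P.complex) 0 ≫
        P.fromLeftDerivedZero' ((tensoringLeft _).obj Z) =
        P.fromLeftDerivedZero' ((tensoringLeft _).obj X) ≫ f ▷ Y := by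
      rw [← cancel_epi (HomologicalComplex.pOpcycles _ _), HomologicalComplex.p_opcyclesMap_assoc,
        ProjectiveResolution.pOpcycles_comp_fromLeftDerivedZero',
        ProjectiveResolution.pOpcycles_comp_fromLeftDerivedZero'_assoc]
      exact (whisker_exchange f (P.π.f 0)).symm
    change _ ≫ HomologicalComplex.homologyι _ 0 ≫
        P.fromLeftDerivedZero' ((tensoringLeft _).obj Z) =
      (HomologicalComplex.homologyι _ 0 ≫
        P.fromLeftDerivedZero' ((tensoringLeft _).obj X)) ≫ f ▷ Y
    rw [HomologicalComplex.homologyι_naturality_assoc, h1, Category.assoc]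
  have h2 : f ▷ Y = (e X).inv ≫ HomologicalComplex.homologyMap
      ((NatTrans.mapHomologicalComplex ((tensoringLeft _).map f) _).app P.complex) 0 ≫ (e Z).hom := by
    rw [h]; simp
  rw [h2]
  constructor
  · intro _; infer_instance
  · intro h3
    rw [mono_comp_iff_of_isIso, mono_comp_iff_of_mono] at h3
    exact h3

def TZ (n : ℕ) (A : Type u) [CommRing A] (M Y : Type u) [AddCommGroup M] [Module A M]
    [AddCommGroup Y] [Module A Y] : Prop :=
  Limits.IsZero (((Tor (ModuleCat.{u} A) n).obj (ModuleCat.of A M)).obj (ModuleCat.of A Y))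

variable {M K F Y : Type u} [AddCommGroup M] [Module A M]
    [AddCommGroup Y] [Module A Y]  [AddCommGroup K] [Module A K]  [AddCommGroup F] [Module A F]

lemma TZ_iff (n : ℕ) (P : ProjectiveResolution (ModuleCat.of A Y)) : TZ n A M Y ↔
    Limits.IsZero (((((tensoringLeft _).obj (ModuleCat.of A M)).mapHomologicalComplex _).obj
      P.complex).homology n) :=
  (P.isoLeftDerivedObj ((tensoringLeft _).obj (ModuleCat.of A M)) n).isZero_iff

noncomputable abbrev sc (i : K →ₗ[A] F) (p : F →ₗ[A] M) (h : Function.Exact i p) :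
    ShortComplex (ModuleCat.{u} A) :=
  ShortComplex.mk (ModuleCat.ofHom i) (ModuleCat.ofHom p)
    (by ext x; exact h.apply_apply_eq_zero x)

lemma sc_shortExact (i : K →ₗ[A] F) (p : F →ₗ[A] M) (h : Function.Exact i p)
    (hi : Function.Injective i) (hp : Function.Surjective p) : (sc i p h).ShortExact where
  exact := (ShortComplex.ShortExact.moduleCat_exact_iff_function_exact _).2 h
  mono_f := (ModuleCat.mono_iff_injective _).2 hi
  epi_g := (ModuleCat.epi_iff_surjective _).2 hp

lemma mono_whisker_iff (i : K →ₗ[A] F) :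
    Mono (ModuleCat.ofHom i ▷ ModuleCat.of A Y) ↔ Function.Injective (i.rTensor Y) :=
  ModuleCat.mono_iff_injective _

/-- If `Tor_1(M,Y)=0` then tensoring preserves injectivity. -/
lemma inj_of_TZ (i : K →ₗ[A] F) (p : F →ₗ[A] M) (h : Function.Exact i p)
    (hi : Function.Injective i) (hp : Function.Surjective p) (hT : TZ 1 A M Y) :
    Function.Injective (i.rTensor Y) := by
  let P := projectiveResolution (ModuleCat.of A Y)
  rw [TZ_iff 1 P] at hT
  have hS := tsc_shortExact (sc_shortExact i p h hi hp) P.complex P.projective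
  rw [← mono_whisker_iff, ← mono_H0_iff _ P]
  exact (hS.homology_exact₁ 1 0 rfl).mono_g (hT.eq_of_src _ _)

lemma TZ_of_inj [Module.Flat A F] (i : K →ₗ[A] F) (p : F →ₗ[A] M) (h : Function.Exact i p)
    (hi : Function.Injective i) (hp : Function.Surjective p)
    (hT : Function.Injective (i.rTensor Y)) : TZ 1 A M Y := by
  let P := projectiveResolution (ModuleCat.of A Y)
  rw [TZ_iff 1 P]
  have hS := tsc_shortExact (sc_shortExact i p h hi hp) P.complex P.projective
  rw [← mono_whisker_iff, ← mono_H0_iff _ P] at hT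
  have h0 : hS.δ 1 0 rfl = 0 := by
    have := hS.δ_comp 1 0 rfl
    have hT' : Mono (HomologicalComplex.homologyMap (tsc (sc i p h) P.complex).f 0) := hT
    rwa [← cancel_mono (HomologicalComplex.homologyMap (tsc (sc i p h) P.complex).f 0),
      Limits.zero_comp]
  have := hS.mono_δ 1 0 rfl (tensor_exactAt _ _ _ (resolution_exactAt P 0))
  rw [h0] at this
  exact @Limits.IsZero.of_mono_zero _ _ _ _ _ this

lemma TZ_shift [Module.Flat A F] (i : K →ₗ[A] F) (p : F →ₗ[A] M) (h : Function.Exact i p)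
    (hi : Function.Injective i) (hp : Function.Surjective p) (n : ℕ) :
    TZ (n + 2) A M Y ↔ TZ (n + 1) A K Y := by
  let P := projectiveResolution (ModuleCat.of A Y)
  rw [TZ_iff _ P, TZ_iff _ P]
  have hS := tsc_shortExact (sc_shortExact i p h hi hp) P.complex P.projective
  exact (hS.δIso (n + 2) (n + 1) rfl (tensor_exactAt _ _ _ (resolution_exactAt P _))
    (tensor_exactAt _ _ _ (resolution_exactAt P _))).isZero_iff

lemma TZ_congr_left (e : K ≃ₗ[A] M) (n : ℕ) : TZ n A K Y ↔ TZ n A M Y :=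
  (((Tor (ModuleCat.{u} A) n).mapIso e.toModuleIso).app (ModuleCat.of A Y)).isZero_iff

lemma TZ_congr_right (e : K ≃ₗ[A] F) (n : ℕ) : TZ n A M K ↔ TZ n A M F :=
  (((Tor (ModuleCat.{u} A) n).obj (ModuleCat.of A M)).mapIso e.toModuleIso).isZero_iff

end cat

open TensorProduct

section alg
variable {R S : Type u} [CommRing R] [CommRing S] [Algebra R S]
  {T : Type u} [AddCommGroup T] [Module R T] [Module S T] [IsScalarTower R S T]

lemma inj_baseChange_iff {K F : Type u} [AddCommGroup K] [Module R K] [AddCommGroup F]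
    [Module R F] (i : K →ₗ[R] F) :
    Function.Injective ((i.baseChange S).rTensor T) ↔ Function.Injective (i.rTensor T) := by
  rw [← LinearMap.lTensor_inj_iff_rTensor_inj, ← LinearMap.lTensor_inj_iff_rTensor_inj]
  let eK := AlgebraTensorModule.cancelBaseChange R S S T K
  let eF := AlgebraTensorModule.cancelBaseChange R S S T F
  have h : ∀ x, eF ((i.baseChange S).lTensor T x) = i.lTensor T (eK x) := by
    intro x
    induction x with
    | zero => simp
    | add x y hx hy => simp only [map_add, hx, hy]
    | tmul t x =>
      induction x with
      | zero => simp
      | add x y hx hy => simp only [TensorProduct.tmul_add, map_add, hx, hy]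
      | tmul s k => simp [eK, eF]
  have h2 : (eF : _ → _) ∘ ((i.baseChange S).lTensor T) = i.lTensor T ∘ (eK : _ → _) := funext h
  rw [← EquivLike.comp_injective _ eF, h2, EquivLike.injective_comp eK]

/-- A syzygy package. -/
lemma exists_syzygy (R : Type u) [CommRing R] (M : Type u) [AddCommGroup M] [Module R M] :
    ∃ (K F : Type u) (_ : AddCommGroup K) (_ : Module R K) (_ : AddCommGroup F) (_ : Module R F)
      (_ : Module.Free R F) (i : K →ₗ[R] F) (p : F →ₗ[R] M), Function.Exact i p ∧
      Function.Injective i ∧ Function.Surjective p :=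
  ⟨LinearMap.ker (Finsupp.linearCombination R (id : M → M)), M →₀ R, inferInstance, inferInstance,
    inferInstance, inferInstance, inferInstance,
    Submodule.subtype _, Finsupp.linearCombination R (id : M → M),
    LinearMap.exact_subtype_ker_map _, Submodule.subtype_injective _,
    Finsupp.linearCombination_id_surjective R M⟩

lemma exists_finite_syzygy (R : Type u) [CommRing R] [IsNoetherianRing R] (M : Type u)
    [AddCommGroup M] [Module R M] [Module.Finite R M] :
    ∃ (K F : Type u) (_ : AddCommGroup K) (_ : Module R K) (_ : AddCommGroup F) (_ : Module R F)
      (_ : Module.Finite R K) (_ : Module.Free R F) (i : K →ₗ[R] F) (p : F →ₗ[R] M),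
      Function.Exact i p ∧ Function.Injective i ∧ Function.Surjective p := by
  obtain ⟨n, p, hp⟩ := Module.Finite.exists_fin' R M
  exact ⟨LinearMap.ker p, Fin n → R, _, _, _, _, inferInstance, inferInstance,
    Submodule.subtype _, p,
    LinearMap.exact_subtype_ker_map _, Submodule.subtype_injective _, hp⟩

lemma baseChange_exact {K F M : Type u} [AddCommGroup K] [Module R K] [AddCommGroup F]
    [Module R F] [AddCommGroup M] [Module R M] {i : K →ₗ[R] F} {p : F →ₗ[R] M}
    (h : Function.Exact i p) (hp : Function.Surjective p) :
    Function.Exact (i.baseChange S) (p.baseChange S) :=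
  lTensor_exact S h hp

lemma baseChange_surj {F M : Type u} [AddCommGroup F]
    [Module R F] [AddCommGroup M] [Module R M] {p : F →ₗ[R] M} (hp : Function.Surjective p) :
    Function.Surjective (p.baseChange S) :=
  LinearMap.lTensor_surjective S hp

lemma baseChange_inj_iff {K F : Type u} [AddCommGroup K] [Module R K] [AddCommGroup F]
    [Module R F] {i : K →ₗ[R] F} :
    Function.Injective (i.baseChange S) ↔ Function.Injective (i.rTensor S) :=
  LinearMap.lTensor_inj_iff_rTensor_inj S i

/-- Under (T1), conditions (T2) and (T3) agree degree by degree. -/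
lemma T2_iff_T3 (n : ℕ) : ∀ (M : Type u) [AddCommGroup M] [Module R M],
    (∀ n, TZ (n + 1) R M S) → (TZ (n + 1) S (S ⊗[R] M) T ↔ TZ (n + 1) R M T) := by
  induction n with
  | zero =>
    intro M _ _ h1
    obtain ⟨K, F, _, _, _, _, _, i, p, h, hi, hp⟩ := exists_syzygy R M
    have hi' := baseChange_inj_iff.2 (inj_of_TZ i p h hi hp (h1 0))
    have h' := baseChange_exact (S := S) h hp
    have hp' := baseChange_surj (S := S) hp
    constructor
    · intro H
      exact TZ_of_inj i p h hi hp ((inj_baseChange_iff i).1 (inj_of_TZ _ _ h' hi' hp' H))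
    · intro H
      exact TZ_of_inj _ _ h' hi' hp' ((inj_baseChange_iff i).2 (inj_of_TZ i p h hi hp H))
  | succ n ih =>
    intro M _ _ h1
    obtain ⟨K, F, _, _, _, _, _, i, p, h, hi, hp⟩ := exists_syzygy R M
    have hi' := baseChange_inj_iff.2 (inj_of_TZ i p h hi hp (h1 0))
    have h' := baseChange_exact (S := S) h hp
    have hp' := baseChange_surj (S := S) hp
    rw [TZ_shift i p h hi hp, TZ_shift _ _ h' hi' hp']
    exact ih K fun m => (TZ_shift i p h hi hp m).1 (h1 (m + 1))

/-- The Nakayama step. -/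
lemma subsingleton_of_tensor [IsLocalRing S] (J : Ideal S)
    (hJ : J ≤ IsLocalRing.maximalIdeal S) (N : Type u) [AddCommGroup N] [Module S N]
    [Module.Finite S N] (h : Subsingleton (N ⊗[S] (S ⧸ J))) : Subsingleton N := by
  have h1 : Subsingleton (N ⧸ (J • (⊤ : Submodule S N))) :=
    (tensorQuotEquivQuotSMul N J).symm.injective.subsingleton
  rw [Submodule.Quotient.subsingleton_iff] at h1
  have h2 : (⊤ : Submodule S N) = ⊥ :=
    Submodule.eq_bot_of_le_smul_of_le_jacobson_bot J ⊤ Module.Finite.fg_top h1.ge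
      (by rwa [IsLocalRing.jacobson_eq_maximalIdeal _ bot_ne_top])
  exact (Submodule.subsingleton_iff S).1 (subsingleton_of_bot_eq_top h2.symm)

lemma inj_aux [IsNoetherianRing S] [IsLocalRing S] (J : Ideal S)
    (hJ : J ≤ IsLocalRing.maximalIdeal S) {X Z W : Type u} [AddCommGroup X] [Module S X]
    [AddCommGroup Z] [Module S Z] [AddCommGroup W] [Module S W] [Module.Finite S X]
    [Module.Flat S Z] (j : X →ₗ[S] Z) (q : Z →ₗ[S] W)
    (h : Function.Exact j q) (hq : Function.Surjective q)
    (h2 : TZ 2 S W (S ⧸ J)) (hK : Function.Injective (j.rTensor (S ⧸ J))) :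
    Function.Injective j := by
  have hL : TZ 1 S (LinearMap.range j) (S ⧸ J) := by
    refine (TZ_shift (LinearMap.range j).subtype q ?_
      (Submodule.subtype_injective _) hq 0).1 h2
    rw [LinearMap.exact_iff, Submodule.range_subtype]
    exact h.linearMap_ker_eq
  have hN : Function.Injective ((LinearMap.ker j).subtype.rTensor (S ⧸ J)) := by
    refine inj_of_TZ (LinearMap.ker j).subtype j.rangeRestrict ?_
      (Submodule.subtype_injective _) j.surjective_rangeRestrict hL
    rw [LinearMap.exact_iff, Submodule.range_subtype, LinearMap.ker_rangeRestrict]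
  have hc : (j.rTensor (S ⧸ J)) ∘ₗ ((LinearMap.ker j).subtype.rTensor (S ⧸ J)) = 0 := by
    rw [← LinearMap.rTensor_comp, LinearMap.comp_ker_subtype, LinearMap.rTensor_zero]
  have hs : Subsingleton ((LinearMap.ker j) ⊗[S] (S ⧸ J)) := by
    refine ⟨fun x y => (hK.comp hN) ?_⟩
    have hx := LinearMap.congr_fun hc x
    have hy := LinearMap.congr_fun hc y
    exact hx.trans hy.symm
  have : Subsingleton (LinearMap.ker j) := subsingleton_of_tensor J hJ _ hs
  exact LinearMap.ker_eq_bot.1 ((Submodule.subsingleton_iff_eq_bot).1 this)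

lemma base_inj [IsNoetherianRing S] [IsLocalRing S] (J : Ideal S)
    (hJ : J ≤ IsLocalRing.maximalIdeal S) {K F M : Type u} [AddCommGroup K] [Module R K]
    [AddCommGroup F] [Module R F] [AddCommGroup M] [Module R M] [Module.Finite R K]
    [Module.Free R F] (i : K →ₗ[R] F) (p : F →ₗ[R] M)
    (h : Function.Exact i p) (hi : Function.Injective i) (hp : Function.Surjective p)
    (h2 : TZ 2 S (S ⊗[R] M) (S ⧸ J)) (h3 : TZ 1 R M (S ⧸ J)) :
    Function.Injective (i.baseChange S) :=
  inj_aux J hJ _ _ (baseChange_exact h hp) (baseChange_surj hp) h2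
    ((inj_baseChange_iff i).2 (inj_of_TZ i p h hi hp h3))

lemma T1_of [IsNoetherianRing R] [IsNoetherianRing S] [IsLocalRing S] (J : Ideal S)
    (hJ : J ≤ IsLocalRing.maximalIdeal S) (n : ℕ) :
    ∀ (M : Type u) [AddCommGroup M] [Module R M] [Module.Finite R M],
    (∀ n, TZ (n + 1) S (S ⊗[R] M) (S ⧸ J)) → (∀ n, TZ (n + 1) R M (S ⧸ J)) →
      TZ (n + 1) R M S := by
  induction n with
  | zero =>
    intro M _ _ _ h2 h3
    obtain ⟨K, F, _, _, _, _, _, _, i, p, h, hi, hp⟩ := exists_finite_syzygy R M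
    exact TZ_of_inj i p h hi hp (baseChange_inj_iff.1 (base_inj J hJ i p h hi hp (h2 1) (h3 0)))
  | succ n ih =>
    intro M _ _ _ h2 h3
    obtain ⟨K, F, _, _, _, _, _, _, i, p, h, hi, hp⟩ := exists_finite_syzygy R M
    have hi' := base_inj J hJ i p h hi hp (h2 1) (h3 0)
    rw [TZ_shift i p h hi hp]
    exact ih K
      (fun m => (TZ_shift _ _ (baseChange_exact h hp) hi' (baseChange_surj hp) m).1 (h2 (m + 1)))
      (fun m => (TZ_shift i p h hi hp m).1 (h3 (m + 1)))

end alg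
end TorAux

open scoped TensorProduct

/-- Let `R` be a complete local Noetherian ring, `a ⊆ b ⊆ m` ideals,
`S = R/a`, `T = R/b` (realised over `S` as `S/(b/a)`), and `Γ` a Noetherian `R`-algebra.
Consider the conditions
(T1) `Tor_n^R(Γ, S) = 0` for all `n > 0`;
(T2) `Tor_n^S(Γ ⊗_R S, T) = 0` for all `n > 0` (with `Γ ⊗_R S = Γ/aΓ`);
(T3) `Tor_n^R(Γ, T) = 0` for all `n > 0`.
Then any two of (T1), (T2), (T3) imply the third. -/
theorem tor_independence_two_of_three
    {R : Type u} [CommRing R] [IsNoetherianRing R] [IsLocalRing R]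
    (hcomplete : IsAdicComplete (IsLocalRing.maximalIdeal R) R)
    (a b : Ideal R) (hab : a ≤ b) (hb : b ≤ IsLocalRing.maximalIdeal R)
    {Γ : Type u} [Ring Γ] [Algebra R Γ] [Module.Finite R Γ] :
    -- abbreviations via `let` are avoided; the three conditions are written out
    (((∀ n : ℕ, 0 < n →
        Limits.IsZero (((Tor (ModuleCat.{u} R) n).obj (ModuleCat.of R Γ)).obj
          (ModuleCat.of R (R ⧸ a)))) →
      (∀ n : ℕ, 0 < n →
        Limits.IsZero (((Tor (ModuleCat.{u} (R ⧸ a)) n).obj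
          (ModuleCat.of (R ⧸ a) (Γ ⧸ (a • ⊤ : Submodule R Γ)))).obj
          (ModuleCat.of (R ⧸ a) ((R ⧸ a) ⧸ (Ideal.map (Ideal.Quotient.mk a) b))))) →
      (∀ n : ℕ, 0 < n →
        Limits.IsZero (((Tor (ModuleCat.{u} R) n).obj (ModuleCat.of R Γ)).obj
          (ModuleCat.of R (R ⧸ b))))) ∧
    ((∀ n : ℕ, 0 < n →
        Limits.IsZero (((Tor (ModuleCat.{u} R) n).obj (ModuleCat.of R Γ)).obj
          (ModuleCat.of R (R ⧸ a)))) →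
      (∀ n : ℕ, 0 < n →
        Limits.IsZero (((Tor (ModuleCat.{u} R) n).obj (ModuleCat.of R Γ)).obj
          (ModuleCat.of R (R ⧸ b)))) →
      (∀ n : ℕ, 0 < n →
        Limits.IsZero (((Tor (ModuleCat.{u} (R ⧸ a)) n).obj
          (ModuleCat.of (R ⧸ a) (Γ ⧸ (a • ⊤ : Submodule R Γ)))).obj
          (ModuleCat.of (R ⧸ a) ((R ⧸ a) ⧸ (Ideal.map (Ideal.Quotient.mk a) b)))))) ∧
    ((∀ n : ℕ, 0 < n →
        Limits.IsZero (((Tor (ModuleCat.{u} (R ⧸ a)) n).obj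
          (ModuleCat.of (R ⧸ a) (Γ ⧸ (a • ⊤ : Submodule R Γ)))).obj
          (ModuleCat.of (R ⧸ a) ((R ⧸ a) ⧸ (Ideal.map (Ideal.Quotient.mk a) b))))) →
      (∀ n : ℕ, 0 < n →
        Limits.IsZero (((Tor (ModuleCat.{u} R) n).obj (ModuleCat.of R Γ)).obj
          (ModuleCat.of R (R ⧸ b)))) →
      (∀ n : ℕ, 0 < n →
        Limits.IsZero (((Tor (ModuleCat.{u} R) n).obj (ModuleCat.of R Γ)).obj
          (ModuleCat.of R (R ⧸ a)))))) := by
  set J : Ideal (R ⧸ a) := Ideal.map (Ideal.Quotient.mk a) b with hJdef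
  have hbt : b ≠ ⊤ := fun h => (IsLocalRing.maximalIdeal.isMaximal R).ne_top (top_le_iff.1 (h ▸ hb))
  have hat : a ≠ ⊤ := fun h => hbt (top_le_iff.1 (h ▸ hab))
  have : Nontrivial (R ⧸ a) := Ideal.Quotient.nontrivial_iff.2 hat
  have : IsLocalRing (R ⧸ a) :=
    IsLocalRing.of_surjective' (Ideal.Quotient.mk a) Ideal.Quotient.mk_surjective
  have hJ : J ≤ IsLocalRing.maximalIdeal (R ⧸ a) := by
    refine IsLocalRing.le_maximalIdeal fun h => hbt ?_
    have h2 := Ideal.comap_map_of_surjective' (Ideal.Quotient.mk a) Ideal.Quotient.mk_surjective b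
    rw [← hJdef, h, Ideal.comap_top, Ideal.mk_ker, sup_eq_left.2 hab] at h2
    exact h2.symm
  let e2 : ((R ⧸ a) ⊗[R] Γ) ≃ₗ[R ⧸ a] (Γ ⧸ (a • ⊤ : Submodule R Γ)) :=
    (TensorProduct.quotTensorEquivQuotSMul Γ a).extendScalarsOfSurjective
      Ideal.Quotient.mk_surjective
  let e3 : ((R ⧸ a) ⧸ J) ≃ₗ[R] (R ⧸ b) := (DoubleQuot.quotQuotEquivQuotOfLEₐ R hab).toLinearEquiv
  have r1 : (∀ n : ℕ, 0 < n →
        Limits.IsZero (((Tor (ModuleCat.{u} R) n).obj (ModuleCat.of R Γ)).obj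
          (ModuleCat.of R (R ⧸ a)))) ↔ ∀ n, TorAux.TZ (n + 1) R Γ (R ⧸ a) :=
    ⟨fun h n => h (n + 1) n.succ_pos, fun h n hn => by
      obtain ⟨m, rfl⟩ := Nat.exists_eq_succ_of_ne_zero hn.ne'
      exact h m⟩
  have r2 : (∀ n : ℕ, 0 < n →
        Limits.IsZero (((Tor (ModuleCat.{u} (R ⧸ a)) n).obj
          (ModuleCat.of (R ⧸ a) (Γ ⧸ (a • ⊤ : Submodule R Γ)))).obj
          (ModuleCat.of (R ⧸ a) ((R ⧸ a) ⧸ J)))) ↔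
      ∀ n, TorAux.TZ (n + 1) (R ⧸ a) ((R ⧸ a) ⊗[R] Γ) ((R ⧸ a) ⧸ J) :=
    ⟨fun h n => (TorAux.TZ_congr_left e2 (n + 1)).2 (h (n + 1) n.succ_pos), fun h n hn => by
      obtain ⟨m, rfl⟩ := Nat.exists_eq_succ_of_ne_zero hn.ne'
      exact (TorAux.TZ_congr_left e2 (m + 1)).1 (h m)⟩
  have r3 : (∀ n : ℕ, 0 < n →
        Limits.IsZero (((Tor (ModuleCat.{u} R) n).obj (ModuleCat.of R Γ)).obj
          (ModuleCat.of R (R ⧸ b)))) ↔ ∀ n, TorAux.TZ (n + 1) R Γ ((R ⧸ a) ⧸ J) :=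
    ⟨fun h n => (TorAux.TZ_congr_right e3 (n + 1)).2 (h (n + 1) n.succ_pos), fun h n hn => by
      obtain ⟨m, rfl⟩ := Nat.exists_eq_succ_of_ne_zero hn.ne'
      exact (TorAux.TZ_congr_right e3 (m + 1)).1 (h m)⟩
  rw [r1, r2, r3]
  exact ⟨fun h1 h2 n => (TorAux.T2_iff_T3 n Γ h1).1 (h2 n),
    fun h1 h3 n => (TorAux.T2_iff_T3 n Γ h1).2 (h3 n),
    fun h2 h3 n => TorAux.T1_of J hJ n Γ h2 h3⟩
end
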